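/- arXiv:1204.0088 — 4 statements merged into one kernel-verified Lean document; each statement's English description precedes it below -/
import Mathlib

section
/- Let v_1,…,v_d (d ≥ 2) be a unimodular sequence of vectors in ℤ², i.e. det(v_i,v_{i+1}) = ±1 for all i cyclically. Set ε_i = det(v_i,v_{i+1}) and let a_i be the unique integers with ε_{i-1}v_{i-1} + ε_i v_{i+1} + a_i v_i = 0. Then the rotation number (winding number) of the closed piecewise-linear loop v_1 → v_2 → … → v_d → v_1 around the origin equals (1/12)(Σ_{i=1}^d a_i + 3 Σ_{i=1}^d ε_i). -/
/-- The determinant of two vectors in `ℤ²`. -/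
def det (p q : ℤ × ℤ) : ℤ := p.1 * q.2 - p.2 * q.1

/-- A lattice point regarded as a complex number. -/
noncomputable def toC (p : ℤ × ℤ) : ℂ := ⟨(p.1 : ℝ), (p.2 : ℝ)⟩

/-- The rotation number around the origin of the closed piecewise-linear loop
`v_1 → v_2 → … → v_d → v_1`: the total signed angle swept divided by `2π`.
Since consecutive vectors of a unimodular sequence are never parallel, the
signed angle from `v_i` to `v_{i+1}` equals `arg(v_{i+1}/v_i) ∈ (−π, π)`. -/
noncomputable def rotationNumber {d : ℕ} [NeZero d] (v : ZMod d → ℤ × ℤ) : ℝ :=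
  (2 * Real.pi)⁻¹ * ∑ i : ZMod d, Complex.arg (toC (v (i + 1)) / toC (v i))

def PP (a b c d : ℤ) : ℤ :=
  if b ≤ 0 ∨ d ≤ 0 then -(a * c)
  else if b < d ∨ (b = d ∧ a < c) then PP a b (c - a) (d - b) + (c * b - d * a)
  else PP (a - c) (b - d) c d + (a * d - b * c)
termination_by (b + d).toNat
decreasing_by all_goals omega

lemma PP_symm (a b c d : ℤ) : PP a b c d = PP c d a b := by
  fun_induction PP a b c d with
  | case1 a b c d h =>
    rw [PP, if_pos (by omega)]; ring
  | case2 a b c d h h2 ih =>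
    conv_rhs => rw [PP, if_neg (by omega), if_neg (by omega)]
    rw [ih]
  | case3 a b c d h h2 ih =>
    by_cases h3 : a = c ∧ b = d
    · obtain ⟨rfl, rfl⟩ := h3
      conv_rhs => rw [PP, if_neg (by omega), if_neg (by omega)]
    · conv_rhs => rw [PP, if_neg (by omega), if_pos (by omega)]
      rw [ih]

def InH (a b : ℤ) : Prop := 0 < b ∨ (b = 0 ∧ 0 < a)

lemma PP_step (a b c d : ℤ) (hb : 0 < b) (h : InH c d) :
    PP a b (c + a) (d + b) = PP a b c d + (c * b - d * a) := by
  unfold InH at h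
  rw [PP, if_neg (by omega), if_pos (by omega)]
  simp only [add_sub_cancel_right]; ring

lemma InH_add (a b c d : ℤ) (hb : 0 < b) (h : InH c d) : InH (c + a) (d + b) := by
  unfold InH at *; omega

lemma PP_steps (a b c d : ℤ) (hb : 0 < b) (h : InH c d) (k : ℕ) :
    InH (c + k * a) (d + k * b) ∧
    PP a b (c + k * a) (d + k * b) = PP a b c d + k * (c * b - d * a) := by
  induction k with
  | zero => simpa using h
  | succ k ih =>
    have e1 : c + ((k + 1 : ℕ) : ℤ) * a = (c + k * a) + a := by push_cast; ring
    have e2 : d + ((k + 1 : ℕ) : ℤ) * b = (d + k * b) + b := by push_cast; ring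
    rw [e1, e2]
    refine ⟨InH_add _ _ _ _ hb ih.1, ?_⟩
    rw [PP_step _ _ _ _ hb ih.1, ih.2]; push_cast; ring

/-- opposite sides: v right of w, u left of w, v + u = (n+1) w -/
lemma PP_opp (a b : ℤ) (hb : 0 < b) (n : ℕ) : ∀ (p q c d : ℤ), InH p q → InH c d →
    p * b - q * a = 1 → a * d - b * c = 1 → p + c = (n + 1) * a → q + d = (n + 1) * b →
    PP a b c d - PP p q a b = 2 - n := by
  induction n with
  | zero =>
    intro p q c d hv hu h1 h2 e1 e2
    have hd : 0 < d := by
      rcases hu with h | ⟨h, h'⟩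
      · exact h
      · subst h; nlinarith
    obtain rfl : a = p + c := by push_cast at e1; linarith
    obtain rfl : b = q + d := by push_cast at e2; linarith
    rw [PP_symm (p + c) (q + d) c d, PP_step c d p q hd hv]
    rcases hv with h | ⟨h, h'⟩
    · rw [add_comm p c, add_comm q d, PP_step p q c d h hu, PP_symm p q c d]
      push_cast; linarith
    · subst h
      have hp : p = 1 := by
        have : p * d = 1 := by linarith
        nlinarith
      subst hp
      have : d = 1 := by linarith
      subst this
      conv_lhs => rw [PP, if_pos (by simp)]
      conv_lhs => arg 2; rw [PP, if_pos (by simp)]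
      push_cast; ring
  | succ n ih =>
    intro p q c d hv hu h1 h2 e1 e2
    push_cast at e1 e2
    by_cases hq : b ≤ q
    · have hv' : InH (p - a) (q - b) := by
        rcases hq.lt_or_eq with h | h
        · left; linarith
        · right; subst h; refine ⟨by ring, ?_⟩
          have : (p - a) * b = 1 := by linarith
          exact pos_of_mul_pos_left (this ▸ one_pos) hb.le
      have := ih (p - a) (q - b) c d hv' hu (by linarith) h2 (by linarith) (by linarith)
      have st := PP_step a b (p - a) (q - b) hb hv'
      simp only [sub_add_cancel] at st
      rw [PP_symm p q a b, st, PP_symm a b (p - a)]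
      push_cast; linarith
    · have hd : b < d := by nlinarith
      have hu' : InH (c - a) (d - b) := by left; linarith
      have := ih p q (c - a) (d - b) hv hu' h1 (by linarith) (by linarith) (by linarith)
      have st := PP_step a b (c - a) (d - b) hb hu'
      simp only [sub_add_cancel] at st
      rw [st]
      push_cast; linarith

lemma opp_aux (a b : ℤ) (hb : 0 < b) (p q c d k : ℤ) (hv : InH p q) (hu : InH c d)
    (h1 : p * b - q * a = 1) (h2 : a * d - b * c = 1) (e1 : p + c + k * a = 0)
    (e2 : q + d + k * b = 0) : PP a b c d - PP p q a b = 3 + k := by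
  have hs : 0 < q + d := by
    rcases hv with h | ⟨h, h'⟩ <;> rcases hu with g | ⟨g, g'⟩
    · linarith
    · linarith
    · linarith
    · subst h g; nlinarith
  have hk : k < 0 := by by_contra hk; push Not at hk; nlinarith
  obtain ⟨n, hn⟩ : ∃ n : ℕ, -k - 1 = n := ⟨(-k-1).toNat, by omega⟩
  have := PP_opp a b hb n p q c d hv hu h1 h2 (by rw [← hn]; linarith) (by rw [← hn]; linarith)
  linarith

lemma same_aux (a b : ℤ) (hb : 0 < b) (p q c d k e : ℤ) (hv : InH p q) (hu : InH c d)
    (he : e = 1 ∨ e = -1)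
    (h1 : p * b - q * a = e) (h2 : a * d - b * c = -e) (e1 : e * p + -e * c + k * a = 0)
    (e2 : e * q + -e * d + k * b = 0) : PP a b c d - PP p q a b = k := by
  have hee : e * e = 1 := by rcases he with rfl | rfl <;> rfl
  have c1 : c = p + (e * k) * a := by linear_combination (-e) * e1 + (p - c) * hee
  have d1 : d = q + (e * k) * b := by linear_combination (-e) * e2 + (q - d) * hee
  rw [PP_symm p q]
  rcases le_total 0 (e * k) with h | h
  · obtain ⟨n, hn⟩ : ∃ n : ℕ, e * k = n := ⟨(e*k).toNat, by omega⟩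
    have := (PP_steps a b p q hb hv n).2
    rw [← hn, ← c1, ← d1, h1] at this
    rw [this]; linear_combination k * hee
  · obtain ⟨n, hn⟩ : ∃ n : ℕ, -(e * k) = n := ⟨(-(e*k)).toNat, by omega⟩
    have := (PP_steps a b c d hb hu n).2
    have p1 : p = c + (-(e * k)) * a := by linear_combination -c1
    have q1 : q = d + (-(e * k)) * b := by linear_combination -d1
    rw [← hn, ← p1, ← q1] at this
    rw [this]; linear_combination k * hee - e * k * h2

lemma PP_trans (a b p q c d k e f : ℤ) (hw : InH a b) (hv : InH p q) (hu : InH c d)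
    (he : e = 1 ∨ e = -1) (hf : f = 1 ∨ f = -1)
    (h1 : p * b - q * a = e) (h2 : a * d - b * c = f) (e1 : e * p + f * c + k * a = 0)
    (e2 : e * q + f * d + k * b = 0) : 2 * (PP a b c d - PP p q a b) = 2 * k + 3 * (e + f) := by
  rcases hw with hb | ⟨rfl, ha⟩
  · rcases he with rfl | rfl <;> rcases hf with rfl | rfl
    · rw [opp_aux a b hb p q c d k hv hu h1 h2 (by linarith) (by linarith)]; ring
    · rw [same_aux a b hb p q c d k 1 hv hu (by simp) h1 h2 e1 e2]; ring
    · rw [same_aux a b hb p q c d k (-1) hv hu (by simp) h1 (by simpa using h2)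
        (by linarith) (by linarith)]; ring
    · have := opp_aux a b hb c d p q (-k) hu hv (by linarith) (by linarith)
        (by linarith) (by linarith)
      rw [PP_symm a b, PP_symm p q]; linarith
  · have hq : 0 < q := by
      rcases hv with h | ⟨h, h'⟩
      · exact h
      · subst h; simp at h1; omega
    have hd : 0 < d := by
      rcases hu with h | ⟨h, h'⟩
      · exact h
      · subst h; simp at h2; omega
    have hf1 : f = 1 := by
      rcases hf with h | h
      · exact h
      · subst h; nlinarith
    have he1 : e = -1 := by
      rcases he with h | h
      · subst h; nlinarith
      · exact h
    subst hf1 he1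
    have had : a * d = 1 := by linarith
    have haq : q * a = 1 := by linarith
    have ha1 : a = 1 := by nlinarith
    subst ha1
    conv_lhs => rw [PP, if_pos (by simp)]
    conv_lhs => arg 2; arg 2; rw [PP, if_pos (by simp)]
    linarith

open Classical in
noncomputable def sg (v : ℤ × ℤ) : ℤ := if InH v.1 v.2 then 1 else -1

lemma sg_cases (v) : sg v = 1 ∨ sg v = -1 := by unfold sg; split_ifs <;> simp

lemma sg_sq (v) : sg v * sg v = 1 := by rcases sg_cases v with h | h <;> rw [h] <;> rfl

lemma sg_InH (v : ℤ × ℤ) (hv : v ≠ 0) : InH (sg v * v.1) (sg v * v.2) := by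
  unfold sg
  split_ifs with h
  · simpa using h
  · have : v.1 ≠ 0 ∨ v.2 ≠ 0 := by
      by_contra h'; push Not at h'; exact hv (Prod.ext h'.1 h'.2)
    unfold InH at *; omega

lemma arg_InH (a b : ℤ) (h : InH a b) : toC (a, b) ≠ 0 ∧ 0 ≤ (toC (a, b)).arg ∧
    (toC (a, b)).arg < Real.pi := by
  have hb : 0 ≤ (toC (a, b)).im := by
    simp only [toC]; unfold InH at h; exact_mod_cast (by omega : 0 ≤ b)
  refine ⟨?_, Complex.arg_nonneg_iff.2 hb, ?_⟩
  · intro h0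
    have h1 := congrArg Complex.re h0
    have h2 := congrArg Complex.im h0
    simp [toC] at h1 h2
    unfold InH at h; omega
  · refine lt_of_le_of_ne (Complex.arg_le_pi _) ?_
    intro h0
    rw [Complex.arg_eq_pi_iff] at h0
    simp only [toC] at h0
    have h1 : a < 0 := by exact_mod_cast h0.1
    have h2 : b = 0 := by exact_mod_cast h0.2
    unfold InH at h; omega

lemma arg_div_InH (z w : ℂ) (hz : z ≠ 0) (hw : w ≠ 0) (h1 : 0 ≤ z.arg) (h2 : z.arg < Real.pi)
    (h3 : 0 ≤ w.arg) (h4 : w.arg < Real.pi) : (w / z).arg = w.arg - z.arg := by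
  have hzp : z.arg ≠ Real.pi := h2.ne
  have e : z⁻¹.arg = - z.arg := by rw [Complex.arg_inv, if_neg hzp]
  rw [div_eq_mul_inv, Complex.arg_mul hw (inv_ne_zero hz), e]
  · ring
  · rw [e]; constructor <;> linarith

lemma im_div (z w : ℂ) : (w / z).im = (z.re * w.im - z.im * w.re) / Complex.normSq z := by
  rw [Complex.div_im]; ring

lemma angle (v w : ℤ × ℤ) (hv : v ≠ 0) (hw : w ≠ 0) (hd : det v w = 1 ∨ det v w = -1) :
    (toC w / toC v).arg = (toC (sg w * w.1, sg w * w.2)).arg - (toC (sg v * v.1, sg v * v.2)).arg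
      + Real.pi / 2 * ((det v w : ℝ) - ((sg v * sg w * det v w : ℤ) : ℝ)) := by
  obtain ⟨z0, z1, z2⟩ := arg_InH _ _ (sg_InH v hv)
  obtain ⟨w0, w1, w2⟩ := arg_InH _ _ (sg_InH w hw)
  rw [← arg_div_InH _ _ z0 w0 z1 z2 w1 w2]
  have ev : toC (sg v * v.1, sg v * v.2) = (sg v : ℂ) * toC v := by
    apply Complex.ext <;> simp [toC]
  have ew : toC (sg w * w.1, sg w * w.2) = (sg w : ℂ) * toC w := by
    apply Complex.ext <;> simp [toC]
  rw [ev] at z0 ⊢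
  rw [ew]
  have zz : toC v ≠ 0 := right_ne_zero_of_mul z0
  have hn : 0 < Complex.normSq (toC v) := Complex.normSq_pos.2 zz
  have him : (toC w / toC v).im = (det v w : ℝ) / Complex.normSq (toC v) := by
    rw [im_div]; simp [toC, det]
  have key : (-(toC w / toC v)).arg = (toC w / toC v).arg - Real.pi * det v w := by
    rcases hd with h | h
    · rw [Complex.arg_neg_eq_arg_sub_pi_of_im_pos]
      · rw [h]; simp
      · rw [him, h]; simpa using hn
    · rw [Complex.arg_neg_eq_arg_add_pi_of_im_neg]
      · rw [h]; simp
      · rw [him, h]; push_cast; rw [neg_div]; simpa using hn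
  rcases sg_cases v with h | h <;> rcases sg_cases w with h' | h' <;> rw [h, h'] <;> push_cast
  · simp
  · rw [one_mul, neg_one_mul, neg_div, key]; ring
  · rw [one_mul, neg_one_mul, div_neg, key]; ring
  · rw [neg_one_mul, neg_one_mul, neg_div_neg_eq]; ring

theorem stmt7 (d : ℕ) (hd : 2 ≤ d) [NeZero d] (v : ZMod d → ℤ × ℤ)
    (hu : ∀ i, det (v i) (v (i + 1)) = 1 ∨ det (v i) (v (i + 1)) = -1)
    (a : ZMod d → ℤ)
    (ha : ∀ i, det (v (i - 1)) (v i) • v (i - 1) + det (v i) (v (i + 1)) • v (i + 1)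
            + a i • v i = 0) :
    rotationNumber v
      = (1 / 12 : ℝ) * ((∑ i : ZMod d, a i : ℤ)
          + 3 * (∑ i : ZMod d, det (v i) (v (i + 1)) : ℤ)) := by
  have hv0 : ∀ i, v i ≠ 0 := by
    intro i h
    have := hu i
    rw [h] at this
    simp [det] at this
  have shift : ∀ {R : Type} [AddCommGroup R] (f : ZMod d → R), ∑ i, f (i + 1) = ∑ i, f i :=
    fun f => Equiv.sum_comp (Equiv.addRight (1 : ZMod d)) f
  set E : ZMod d → ℤ := fun i => sg (v i) * sg (v (i + 1)) * det (v i) (v (i + 1)) with hE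
  set Q : ZMod d → ℤ := fun i => PP (sg (v i) * (v i).1) (sg (v i) * (v i).2)
    (sg (v (i + 1)) * (v (i + 1)).1) (sg (v (i + 1)) * (v (i + 1)).2) with hQ
  have hEc : ∀ i, E i = 1 ∨ E i = -1 := by
    intro i
    simp only [hE]
    rcases sg_cases (v i) with h | h <;> rcases sg_cases (v (i + 1)) with h' | h' <;>
      rcases hu i with h'' | h'' <;> rw [h, h', h''] <;> simp
  have local_rel : ∀ i, 2 * (Q (i + 1) - Q i) = 2 * a (i + 1) + 3 * (E i + E (i + 1)) := by
    intro i
    have h := ha (i + 1)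
    rw [add_sub_cancel_right] at h
    have h1 := congrArg Prod.fst h
    have h2 := congrArg Prod.snd h
    simp only [Prod.fst_add, Prod.snd_add, Prod.smul_fst, Prod.smul_snd, smul_eq_mul,
      Prod.fst_zero, Prod.snd_zero] at h1 h2
    have s0 := sg_sq (v i)
    have s1 := sg_sq (v (i + 1))
    have s2 := sg_sq (v (i + 1 + 1))
    apply PP_trans _ _ _ _ _ _ _ _ _ (sg_InH _ (hv0 (i + 1))) (sg_InH _ (hv0 i))
      (sg_InH _ (hv0 (i + 1 + 1))) (hEc i) (hEc (i + 1))
    · simp only [hE, det]; ring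
    · simp only [hE, det]; ring
    · simp only [hE]
      linear_combination sg (v (i + 1)) * h1
        + sg (v (i + 1)) * det (v i) (v (i + 1)) * (v i).1 * s0
        + sg (v (i + 1)) * det (v (i + 1)) (v (i + 1 + 1)) * (v (i + 1 + 1)).1 * s2
    · simp only [hE]
      linear_combination sg (v (i + 1)) * h2
        + sg (v (i + 1)) * det (v i) (v (i + 1)) * (v i).2 * s0
        + sg (v (i + 1)) * det (v (i + 1)) (v (i + 1 + 1)) * (v (i + 1 + 1)).2 * s2
  have hsum : (0 : ℤ) = 2 * ∑ i, a i + 6 * ∑ i, E i := by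
    have h := Finset.sum_congr (rfl : (Finset.univ : Finset (ZMod d)) = Finset.univ)
      (fun i _ => local_rel i)
    simp only [← Finset.mul_sum, Finset.sum_add_distrib, Finset.sum_sub_distrib] at h
    rw [shift Q, shift a, shift E] at h
    linarith
  have hang : ∑ i, (toC (v (i + 1)) / toC (v i)).arg
      = Real.pi / 2 * (((∑ i, det (v i) (v (i + 1)) : ℤ) : ℝ) - ((∑ i, E i : ℤ) : ℝ)) := by
    rw [Finset.sum_congr rfl (fun i _ => angle (v i) (v (i + 1)) (hv0 _) (hv0 _) (hu i))]
    rw [Finset.sum_add_distrib, Finset.sum_sub_distrib,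
      shift (fun i => (toC (sg (v i) * (v i).1, sg (v i) * (v i).2)).arg), sub_self, zero_add,
      ← Finset.mul_sum, Finset.sum_sub_distrib]
    push_cast [hE]
    rfl
  have hsumR : (0 : ℝ) = 2 * ((∑ i, a i : ℤ) : ℝ) + 6 * ((∑ i, E i : ℤ) : ℝ) := by
    exact_mod_cast hsum
  rw [rotationNumber, hang]
  have hpi := Real.pi_ne_zero
  have : (2 * Real.pi)⁻¹ * (Real.pi / 2 *
      (((∑ i, det (v i) (v (i + 1)) : ℤ) : ℝ) - ((∑ i, E i : ℤ) : ℝ)))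
      = (1 / 4) * (((∑ i, det (v i) (v (i + 1)) : ℤ) : ℝ) - ((∑ i, E i : ℤ) : ℝ)) := by
    field_simp; norm_num; ring
  rw [this]
  linarith
end

section
/- Let v_1,…,v_d be a unimodular sequence in ℤ² defining a legal loop P with dual loop P∨ = (w_1,…,w_d), where w_i = ε_{i-1}(v_i − v_{i-1}). Define B(P) = Σ_i ε_i and B(P∨) = Σ_i sgn(det(w_i,w_{i+1}))·|w_i w_{i+1}|, where |w_i w_{i+1}| denotes the number of lattice points on the segment from w_i to w_{i+1} minus 1 (taken to be 0 if w_i = w_{i+1}). Then B(P) + B(P∨) = 12r, where r is the rotation number of v_1,…,v_d around the origin. -/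
/-- The number of lattice points on the segment from `p` to `q` minus one
(`0` if `p = q`), i.e. `gcd` of the coordinate differences. -/
def segLen (p q : ℤ × ℤ) : ℤ := Int.gcd (q.1 - p.1) (q.2 - p.2)

/-- Dedekind-type function, defined by descending along Farey neighbours. -/
noncomputable def phi (a : ℤ) (b : ℕ) : ℝ :=
  if h : b ≤ 1 then 3 - (a : ℝ) else
    phi ((a * (Int.gcdA a b % (b : ℤ)) - 1) / b) (Int.gcdA a b % (b : ℤ)).toNat
      + (b : ℝ) / ((Int.gcdA a b % (b : ℤ)).toNat : ℝ)
      + ((Int.gcdA a b % (b : ℤ)).toNat : ℝ) / (b : ℝ) - 3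
termination_by b
decreasing_by
  have h1 : (0 : ℤ) < b := by omega
  have := Int.emod_lt_of_pos (Int.gcdA a b) h1
  have := Int.emod_nonneg (Int.gcdA a b) h1.ne'
  omega

lemma phi_one (a : ℤ) : phi a 1 = 3 - a := by
  rw [phi]; simp

lemma phi_step (a c : ℤ) (b e : ℕ) (he : 0 < e) (hlt : e < b) (h : a * e - b * c = 1) :
    phi a b = phi c e + (b : ℝ) / e + (e : ℝ) / b - 3 := by
  have hb : ¬ b ≤ 1 := by omega
  have hb0 : (0 : ℤ) < b := by omega
  have hg : Int.gcd a b = 1 := by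
    have : IsCoprime a (b : ℤ) := ⟨e, -c, by linarith⟩
    exact Int.isCoprime_iff_gcd_eq_one.mp this
  have hbez := Int.gcd_eq_gcd_ab a b
  rw [hg] at hbez
  have hmod : Int.gcdA a b % (b : ℤ) = e := by
    have h1 : (e : ℤ) % b = e := Int.emod_eq_of_lt (by omega) (by omega)
    rw [← h1]
    apply Int.ModEq.symm
    apply (Int.modEq_iff_dvd).mpr
    refine ⟨Int.gcdA a b * -c - e * Int.gcdB a b, ?_⟩
    push_cast at hbez
    linear_combination (-Int.gcdA a b) * h - (e : ℤ) * hbez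
  have hdiv : (a * (e : ℤ) - 1) / b = c := by
    apply Int.ediv_eq_of_eq_mul_right hb0.ne'
    linarith
  rw [phi, dif_neg hb, hmod, hdiv]
  simp

lemma phi_edge (n : ℕ) : ∀ (a c : ℤ) (b e : ℕ), b + e ≤ n → 0 < b → 0 < e → a * e - b * c = 1 →
    phi a b - phi c e = (b : ℝ) / e + (e : ℝ) / b - 3 := by
  induction n with
  | zero => intro a c b e h1 h2; omega
  | succ n ih =>
    intro a c b e hn hb he h
    rcases lt_trichotomy e b with hlt | heq | hgt
    · rw [phi_step a c b e he hlt h]; ring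
    · subst heq
      have h1 : (e : ℤ) * (a - c) = 1 := by linarith
      have h2 : (e : ℤ) = 1 := Int.eq_one_of_mul_eq_one_right (by omega) h1
      have h3 : e = 1 := by omega
      subst h3
      rw [phi_one, phi_one]
      have h4 : (a : ℝ) - c = 1 := by
        have : a - c = 1 := by simpa using h1
        exact_mod_cast this
      push_cast
      linarith
    · obtain ⟨k, rfl⟩ := Nat.exists_eq_add_of_lt hgt
      have hk : 0 < k + 1 := by omega
      have e1 := phi_step c (c - a) (b + k + 1) (k + 1) hk (by omega)
        (by push_cast at h ⊢; linarith)
      have e2 := ih a (c - a) b (k + 1) (by omega) hb hk (by push_cast at h ⊢; linarith)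
      have hb' : (b : ℝ) ≠ 0 := by positivity
      have hk' : (k : ℝ) + 1 ≠ 0 := by positivity
      have hbk' : (b : ℝ) + k + 1 ≠ 0 := by positivity
      rw [e1]
      have : phi a b = phi (c - a) (k + 1) + ((b : ℝ) / (k + 1 : ℕ) + ((k + 1 : ℕ) : ℝ) / b - 3) := by
        linarith
      rw [this]
      push_cast
      field_simp
      ring

lemma arctan_aux (t s : ℝ) (h : s < t) :
    Real.arctan ((1 + t * s) / (t - s)) = Real.pi / 2 - Real.arctan t + Real.arctan s := by
  have hlt := Real.arctan_strictMono h
  have b1 := Real.arctan_lt_pi_div_two t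
  have b2 := Real.neg_pi_div_two_lt_arctan s
  have ct := Real.cos_arctan_pos t
  have cs := Real.cos_arctan_pos s
  have st : Real.sin (Real.arctan t) = t * Real.cos (Real.arctan t) := by
    rw [← Real.tan_mul_cos ct.ne', Real.tan_arctan]
  have ss : Real.sin (Real.arctan s) = s * Real.cos (Real.arctan s) := by
    rw [← Real.tan_mul_cos cs.ne', Real.tan_arctan]
  have key : Real.tan (Real.pi / 2 - (Real.arctan t - Real.arctan s)) = (1 + t * s) / (t - s) := by
    have hts : t - s ≠ 0 := by linarith
    rw [Real.tan_eq_sin_div_cos, Real.sin_pi_div_two_sub, Real.cos_pi_div_two_sub,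
      Real.cos_sub, Real.sin_sub, st, ss]
    have : t * Real.cos (Real.arctan t) * Real.cos (Real.arctan s)
        - Real.cos (Real.arctan t) * (s * Real.cos (Real.arctan s))
        = (t - s) * (Real.cos (Real.arctan t) * Real.cos (Real.arctan s)) := by ring
    rw [this]
    have hc : Real.cos (Real.arctan t) * Real.cos (Real.arctan s) ≠ 0 := by positivity
    rw [div_eq_div_iff (mul_ne_zero hts hc) hts]
    ring
  rw [← key, Real.arctan_tan] <;> linarith

lemma arg_aux (x ε r : ℝ) (hε : ε = 1 ∨ ε = -1) (hr : 0 < r) :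
    Complex.arg ⟨r * x, r * ε⟩ = ε * (Real.pi / 2 - Real.arctan x) := by
  have b1 := Real.arctan_lt_pi_div_two x
  have b2 := Real.neg_pi_div_two_lt_arctan x
  have hs : 0 < √(1 + x ^ 2) := Real.sqrt_pos.mpr (by positivity)
  have hz : (⟨r * x, r * ε⟩ : ℂ) = ((r * √(1 + x ^ 2) : ℝ) : ℂ) *
      (Complex.cos ((ε * (Real.pi / 2 - Real.arctan x) : ℝ) : ℂ)
        + Complex.sin ((ε * (Real.pi / 2 - Real.arctan x) : ℝ) : ℂ) * Complex.I) := by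
    rw [← Complex.ofReal_cos, ← Complex.ofReal_sin]
    apply Complex.ext <;>
      simp only [Complex.mul_re, Complex.mul_im, Complex.add_re, Complex.add_im, Complex.ofReal_re,
        Complex.ofReal_im, Complex.I_re, Complex.I_im, mul_zero, mul_one, zero_mul, sub_zero,
        add_zero, zero_add]
    · rcases hε with rfl | rfl
      · simp only [one_mul, Real.cos_pi_div_two_sub, Real.sin_arctan]; field_simp
      · simp only [neg_mul, one_mul, Real.cos_neg, Real.cos_pi_div_two_sub, Real.sin_arctan]; field_simp
    · rcases hε with rfl | rfl
      · simp only [one_mul, Real.sin_pi_div_two_sub, Real.cos_arctan]; field_simp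
      · simp only [neg_mul, one_mul, Real.sin_neg, Real.sin_pi_div_two_sub, Real.cos_arctan]; field_simp
  rw [hz, Complex.arg_mul_cos_add_sin_mul_I (by positivity)]
  rcases hε with rfl | rfl <;> constructor <;> linarith

lemma arg_edge (u v : ℤ × ℤ) (h : det u v = 1 ∨ det u v = -1) :
    3 * (det u v : ℝ) - 6 / Real.pi * Complex.arg (toC v / toC u)
      = 6 / Real.pi * Real.arctan (det u v * (u.1 * v.1 + u.2 * v.2)) := by
  have hN : 0 < ((u.1 : ℝ) ^ 2 + (u.2 : ℝ) ^ 2) := by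
    have : u.1 ≠ 0 ∨ u.2 ≠ 0 := by
      by_contra hh
      push Not at hh
      simp [det, hh.1, hh.2] at h
    rcases this with h | h
    · have : (u.1 : ℝ) ≠ 0 := by exact_mod_cast h
      positivity
    · have : (u.2 : ℝ) ≠ 0 := by exact_mod_cast h
      positivity
  have hε : (det u v : ℝ) = 1 ∨ (det u v : ℝ) = -1 := by
    rcases h with h | h <;> simp [h]
  have hq : toC v / toC u = ⟨((u.1 : ℝ) ^ 2 + (u.2 : ℝ) ^ 2)⁻¹ * (u.1 * v.1 + u.2 * v.2),
      ((u.1 : ℝ) ^ 2 + (u.2 : ℝ) ^ 2)⁻¹ * (det u v : ℝ)⟩ := by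
    apply Complex.ext
    · simp [toC, Complex.div_re, Complex.normSq_apply]; field_simp
    · simp [toC, Complex.div_im, Complex.normSq_apply, det]; field_simp
  rw [hq, arg_aux _ _ _ hε (inv_pos.mpr hN)]
  have := Real.pi_ne_zero
  rcases hε with h | h <;> rw [h]
  · rw [one_mul, one_mul]; field_simp; ring
  · rw [neg_one_mul, neg_one_mul, Real.arctan_neg]; field_simp; ring

/-- Slope-type coordinate of the neighbour `v` of `u`. -/
noncomputable def kap (u v : ℤ × ℤ) : ℝ :=
  if u.2 = 0 then det u v * v.1 * u.1
  else det u v * v.2 / u.2 - phi (u.2.sign * u.1) u.2.natAbs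

/-- The potential. -/
noncomputable def pot (u : ℤ × ℤ) : ℝ :=
  if u.2 = 0 then 3 else 6 / Real.pi * Real.arctan (u.1 / u.2)

lemma det_swap (u v : ℤ × ℤ) : det v u = - det u v := by
  simp only [det]; ring

lemma edge_zero (u v : ℤ × ℤ) (h : det u v = 1 ∨ det u v = -1) (hu : u.2 = 0) :
    kap v u - kap u v + 6 / Real.pi * Real.arctan (det u v * (u.1 * v.1 + u.2 * v.2))
      = pot v - pot u := by
  obtain ⟨x, y⟩ := u
  obtain ⟨z, t⟩ := v
  simp only at hu
  subst hu
  have hx : x * t = 1 ∨ x * t = -1 := by simpa [det] using h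
  have ht : t = 1 ∨ t = -1 := by
    rcases hx with hx | hx
    · exact Int.isUnit_iff.mp (IsUnit.of_mul_eq_one x (by linarith))
    · exact Int.isUnit_iff.mp (IsUnit.of_mul_eq_one (-x) (by linarith))
  have hx' : x = 1 ∨ x = -1 := by
    rcases ht with rfl | rfl <;> omega
  rcases ht with rfl | rfl <;> rcases hx' with rfl | rfl <;>
    simp [kap, pot, det, phi_one, div_neg, Real.arctan_neg] <;> ring

lemma edge_pos (u v : ℤ × ℤ) (h : det u v = 1 ∨ det u v = -1) (hu : u.2 ≠ 0) (hv : v.2 ≠ 0)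
    (hp : 0 < det u v * (u.2 * v.2)) :
    kap v u - kap u v + 6 / Real.pi * Real.arctan (det u v * (u.1 * v.1 + u.2 * v.2))
      = pot v - pot u := by
  have hu' : (u.2 : ℝ) ≠ 0 := by exact_mod_cast hu
  have hv' : (v.2 : ℝ) ≠ 0 := by exact_mod_cast hv
  have hp' : (0 : ℝ) < det u v * (u.2 * v.2) := by exact_mod_cast hp
  have hsq : (det u v : ℝ) * det u v = 1 := by rcases h with h | h <;> simp [h]
  have hd : (det u v : ℝ) = u.1 * v.2 - u.2 * v.1 := by simp [det]
  have hdiff : (u.1 : ℝ) / u.2 - v.1 / v.2 = det u v * (u.2 * v.2) / (u.2 * v.2) ^ 2 := by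
    rw [hd]; field_simp
  have hlt : (v.1 : ℝ) / v.2 < u.1 / u.2 := by
    rw [← sub_pos, hdiff]; positivity
  have harg : (det u v : ℝ) * (u.1 * v.1 + u.2 * v.2)
      = (1 + (u.1 : ℝ) / u.2 * (v.1 / v.2)) / ((u.1 : ℝ) / u.2 - v.1 / v.2) := by
    have hd0 : (det u v : ℝ) ≠ 0 := by intro h0; simp [h0] at hsq
    rw [hdiff]
    field_simp
    rw [pow_two, hsq]; ring
  rw [harg, arctan_aux _ _ hlt]
  have hphi := phi_edge _ (u.2.sign * u.1) (v.2.sign * v.1) u.2.natAbs v.2.natAbs le_rfl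
    (by omega) (by omega) (by
      have e1 := Int.sign_mul_natAbs u.2
      have e2 := Int.sign_mul_natAbs v.2
      have h2 : det u v = u.2.sign * v.2.sign := by
        rcases h with h | h <;> rw [h] at hp ⊢ <;> rcases lt_or_gt_of_ne hu with a | a <;>
          rcases lt_or_gt_of_ne hv with b | b <;>
          simp only [Int.sign_eq_one_of_pos, Int.sign_eq_neg_one_of_neg, a, b] <;> nlinarith
      have s1 : u.2.sign * u.2.sign = 1 := by
        rcases lt_or_gt_of_ne hu with a | a <;>
          simp [Int.sign_eq_one_of_pos, Int.sign_eq_neg_one_of_neg, a]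
      have s2 : v.2.sign * v.2.sign = 1 := by
        rcases lt_or_gt_of_ne hv with a | a <;>
          simp [Int.sign_eq_one_of_pos, Int.sign_eq_neg_one_of_neg, a]
      have f1 : (u.2.natAbs : ℤ) = u.2.sign * u.2 := by
        rw [← Int.abs_eq_natAbs, Int.sign_mul_self_eq_abs]
      have f2 : (v.2.natAbs : ℤ) = v.2.sign * v.2 := by
        rw [← Int.abs_eq_natAbs, Int.sign_mul_self_eq_abs]
      rw [f1, f2]
      calc _ = u.2.sign * v.2.sign * det u v := by simp only [det]; ring
        _ = 1 := by rw [h2]; linear_combination (v.2.sign * v.2.sign) * s1 + s2)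
  have n1 : (u.2.natAbs : ℝ) = |(u.2 : ℝ)| := by simp
  have n2 : (v.2.natAbs : ℝ) = |(v.2 : ℝ)| := by simp
  have q : (u.2.natAbs : ℝ) / v.2.natAbs + (v.2.natAbs : ℝ) / u.2.natAbs
      = det u v * (u.2 / v.2 + v.2 / u.2) := by
    rw [n1, n2, ← abs_div, ← abs_div]
    rcases h with h | h <;> rw [h] at hp' ⊢ <;> push_cast at hp' ⊢
    · have : (0 : ℝ) < u.2 * v.2 := by linarith
      have a1 : (0 : ℝ) < u.2 / v.2 := by
        have : (u.2 : ℝ) / v.2 = u.2 * v.2 / v.2 ^ 2 := by field_simp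
        rw [this]; positivity
      have a2 : (0 : ℝ) < v.2 / u.2 := by rw [← inv_div]; positivity
      rw [abs_of_pos a1, abs_of_pos a2]; ring
    · have h0 : (0 : ℝ) < -(u.2 * v.2) := by linarith
      have a1 : (0 : ℝ) < -(u.2 / v.2) := by
        have : -((u.2 : ℝ) / v.2) = -(u.2 * v.2) / v.2 ^ 2 := by field_simp
        rw [this]; positivity
      have a2 : (0 : ℝ) < -(v.2 / u.2) := by
        have : -((v.2 : ℝ) / u.2) = -(u.2 * v.2) / u.2 ^ 2 := by field_simp
        rw [this]; positivity
      rw [abs_of_neg (by linarith), abs_of_neg (by linarith)]; ring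
  rw [q] at hphi
  simp only [kap, pot, hu, hv, if_false, det_swap u v]
  push_cast
  have hpi := Real.pi_ne_zero
  have e6 : 6 / Real.pi * (Real.pi / 2 - Real.arctan (u.1 / u.2) + Real.arctan (v.1 / v.2))
      = 3 - 6 / Real.pi * Real.arctan (u.1 / u.2) + 6 / Real.pi * Real.arctan (v.1 / v.2) := by
    field_simp; ring
  rw [e6]
  linear_combination hphi

lemma edge (u v : ℤ × ℤ) (h : det u v = 1 ∨ det u v = -1) :
    kap v u - kap u v + 3 * (det u v : ℝ) - 6 / Real.pi * Complex.arg (toC v / toC u)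
      = pot v - pot u := by
  have key : kap v u - kap u v
      + 6 / Real.pi * Real.arctan (det u v * (u.1 * v.1 + u.2 * v.2)) = pot v - pot u := by
    have h' : det v u = 1 ∨ det v u = -1 := by rw [det_swap]; omega
    have flip : ∀ (X : kap u v - kap v u
      + 6 / Real.pi * Real.arctan (det v u * (v.1 * u.1 + v.2 * u.2)) = pot u - pot v),
      kap v u - kap u v
      + 6 / Real.pi * Real.arctan (det u v * (u.1 * v.1 + u.2 * v.2)) = pot v - pot u := by
      intro X
      have : ((det v u : ℤ) : ℝ) * (v.1 * u.1 + v.2 * u.2)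
          = -(det u v * (u.1 * v.1 + u.2 * v.2)) := by
        rw [det_swap]; push_cast; ring
      rw [this, Real.arctan_neg] at X
      linarith
    by_cases hu : u.2 = 0
    · exact edge_zero u v h hu
    by_cases hv : v.2 = 0
    · exact flip (edge_zero v u h' hv)
    have hne : det u v * (u.2 * v.2) ≠ 0 :=
      mul_ne_zero (by omega) (mul_ne_zero hu hv)
    rcases lt_or_gt_of_ne hne with hl | hg
    · exact flip (edge_pos v u h' hv hu (by rw [det_swap]; linarith))
    · exact edge_pos u v h hu hv hg
  have := arg_edge u v h
  linarith

lemma local_term (p q r : ℤ × ℤ) (h1 : det p q = 1 ∨ det p q = -1)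
    (h2 : det q r = 1 ∨ det q r = -1) :
    (((det (det p q • (q - p)) (det q r • (r - q))).sign *
      segLen (det p q • (q - p)) (det q r • (r - q)) : ℤ) : ℝ)
      = det p q + det q r + kap q p - kap q r := by
  set a : ℤ := - (det p q * det q r * det p r) with ha
  set c : ℤ := det p q + det q r + a with hc
  have s1 : det p q * det p q = 1 := by rcases h1 with h | h <;> simp [h]
  have s2 : det q r * det q r = 1 := by rcases h2 with h | h <;> simp [h]
  have r1 : det p q * p.1 + det q r * r.1 + a * q.1 = 0 := by
    have : det q r * p.1 + det p q * r.1 - det p r * q.1 = 0 := by simp only [det]; ring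
    rw [ha]
    linear_combination (det p q * det q r) * this - (det p q * p.1) * s2 - (det q r * r.1) * s1
  have r2 : det p q * p.2 + det q r * r.2 + a * q.2 = 0 := by
    have : det q r * p.2 + det p q * r.2 - det p r * q.2 = 0 := by simp only [det]; ring
    rw [ha]
    linear_combination (det p q * det q r) * this - (det p q * p.2) * s2 - (det q r * r.2) * s1
  have hdet : det (det p q • (q - p)) (det q r • (r - q)) = c := by
    have : det (det p q • (q - p)) (det q r • (r - q))
        = det p q * det q r * (det p q + det q r - det p r) := by
      simp only [det, Prod.smul_fst, Prod.smul_snd, Prod.fst_sub, Prod.snd_sub, smul_eq_mul]; ring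
    rw [this, hc, ha]
    linear_combination (det q r) * s1 + (det p q) * s2
  have hg : Int.gcd q.1 q.2 = 1 := by
    apply Int.isCoprime_iff_gcd_eq_one.mp
    refine ⟨det q r * r.2, - det q r * r.1, ?_⟩
    rw [← s2]
    conv_rhs => rw [det]
    simp only [det]; ring
  have hseg : segLen (det p q • (q - p)) (det q r • (r - q)) = |c| := by
    have g1 : (det q r • (r - q)).1 - (det p q • (q - p)).1 = -c * q.1 := by
      simp only [Prod.smul_fst, Prod.fst_sub, smul_eq_mul]
      rw [hc]; linear_combination r1
    have g2 : (det q r • (r - q)).2 - (det p q • (q - p)).2 = -c * q.2 := by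
      simp only [Prod.smul_snd, Prod.snd_sub, smul_eq_mul]
      rw [hc]; linear_combination r2
    rw [segLen, g1, g2, Int.gcd_mul_left, hg]
    simp
  rw [hdet, hseg, Int.sign_mul_abs]
  have hk : (a : ℝ) = kap q p - kap q r := by
    have r1' : (det p q : ℝ) * p.1 + det q r * r.1 + a * q.1 = 0 := by exact_mod_cast r1
    have r2' : (det p q : ℝ) * p.2 + det q r * r.2 + a * q.2 = 0 := by exact_mod_cast r2
    by_cases hq : q.2 = 0
    · have hq1 : (q.1 : ℝ) * q.1 = 1 := by
        rw [hq] at hg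
        have : q.1.natAbs = 1 := by simpa using hg
        have : q.1 = 1 ∨ q.1 = -1 := by omega
        rcases this with h | h <;> simp [h]
      simp only [kap, hq, if_true, det_swap p q]
      push_cast
      linear_combination q.1 * r1' - a * hq1
    · have hq' : (q.2 : ℝ) ≠ 0 := by exact_mod_cast hq
      simp only [kap, hq, if_false, det_swap p q]
      push_cast
      field_simp
      linear_combination r2'
  rw [hc]; push_cast; linarith


/-- generalized twelve-point theorem for a legal loop coming from
a unimodular sequence: with `w_i = ε_{i-1}(v_i − v_{i-1})`,
`B(P) = Σ ε_i` and `B(P∨) = Σ sgn(det(w_i, w_{i+1})) · |w_i w_{i+1}|`,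
one has `B(P) + B(P∨) = 12 r` where `r` is the rotation number of
`v_1, …, v_d` around the origin. -/
theorem stmt11 (d : ℕ) (hd : 2 ≤ d) [NeZero d] (v : ZMod d → ℤ × ℤ)
    (hu : ∀ i, det (v i) (v (i + 1)) = 1 ∨ det (v i) (v (i + 1)) = -1)
    (w : ZMod d → ℤ × ℤ)
    (hw : ∀ i, w i = det (v (i - 1)) (v i) • (v i - v (i - 1))) :
    ((∑ i : ZMod d, det (v i) (v (i + 1))
        + ∑ i : ZMod d, (det (w i) (w (i + 1))).sign * segLen (w i) (w (i + 1)) : ℤ) : ℝ)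
      = 12 * rotationNumber v := by
  have hterm : ∀ i : ZMod d,
      (((det (w i) (w (i + 1))).sign * segLen (w i) (w (i + 1)) : ℤ) : ℝ)
      = det (v (i - 1)) (v i) + det (v i) (v (i + 1)) + kap (v i) (v (i - 1))
        - kap (v i) (v (i + 1)) := by
    intro i
    have h1 := hu (i - 1)
    rw [sub_add_cancel] at h1
    have := local_term (v (i - 1)) (v i) (v (i + 1)) h1 (hu i)
    rw [hw i, hw (i + 1), add_sub_cancel_right]
    exact this
  have sh : ∀ F : ZMod d → ℝ, ∑ i, F (i + 1) = ∑ i, F i := fun F =>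
    Equiv.sum_comp (Equiv.addRight (1 : ZMod d)) F
  have s1 := sh (fun i => (det (v (i - 1)) (v i) : ℝ))
  have s2 := sh (fun i => kap (v i) (v (i - 1)))
  have s3 := sh (fun i => pot (v i))
  simp only [add_sub_cancel_right] at s1 s2
  have hedge : ∑ i : ZMod d, (kap (v (i + 1)) (v i) - kap (v i) (v (i + 1))
      + 3 * (det (v i) (v (i + 1)) : ℝ)
      - 6 / Real.pi * Complex.arg (toC (v (i + 1)) / toC (v i)))
      = ∑ i : ZMod d, (pot (v (i + 1)) - pot (v i)) :=
    Finset.sum_congr rfl fun i _ => edge _ _ (hu i)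
  simp only [Finset.sum_sub_distrib, Finset.sum_add_distrib, ← Finset.mul_sum] at hedge
  rw [Int.cast_add, Int.cast_sum, Int.cast_sum, Finset.sum_congr rfl fun i _ => hterm i]
  simp only [Finset.sum_sub_distrib, Finset.sum_add_distrib]
  have hr : 12 * rotationNumber v
      = 6 / Real.pi * ∑ i : ZMod d, Complex.arg (toC (v (i + 1)) / toC (v i)) := by
    rw [rotationNumber]
    have := Real.pi_ne_zero
    field_simp
    ring
  rw [hr]
  linarith
end

section
/- Let P be a convex lattice polygon in ℝ² whose only interior lattice point is the origin. Then B(P) + B(P∨) = 12, where B(Q) denotes the number of lattice points on the boundary of a lattice polygon Q and P∨ = {u ∈ ℝ² : ⟨u, v⟩ ≥ −1 for all v ∈ P} is the dual polygon (which is again a convex lattice polygon with the origin as its only interior lattice point). -/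
/-- A lattice point regarded as a point of the real plane. -/
def toR (p : ℤ × ℤ) : ℝ × ℝ := ((p.1 : ℝ), (p.2 : ℝ))

def ip (u v : ℤ × ℤ) : ℤ := u.1 * v.1 + u.2 * v.2
def dt (u v : ℤ × ℤ) : ℤ := u.1 * v.2 - u.2 * v.1

structure Rfl (T : Finset (ℤ × ℤ)) : Prop where
  zero : (0, 0) ∉ T
  mem : ∀ s ∈ T, ∀ t ∈ T, ∀ p : ℤ × ℤ, p ≠ (0, 0) → ∀ n a b : ℤ, 0 < n → 0 ≤ a → 0 ≤ b →
    n * p.1 = a * s.1 + b * t.1 → n * p.2 = a * s.2 + b * t.2 → a + b ≤ n → p ∈ T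
  le : ∀ s ∈ T, ∀ t ∈ T, ∀ p : ℤ × ℤ, p ≠ (0, 0) → ∀ n a b : ℤ, 0 < n → 0 ≤ a → 0 ≤ b →
    n * p.1 = a * s.1 + b * t.1 → n * p.2 = a * s.2 + b * t.2 → n ≤ a + b
  span : ∀ v : ℤ × ℤ, v ≠ (0, 0) → ∃ s ∈ T, 0 < dt v s

def dualSet (T : Finset (ℤ × ℤ)) : Set (ℤ × ℤ) := {u | u ≠ (0, 0) ∧ ∀ t ∈ T, -1 ≤ ip u t}

lemma Rfl.ne {T : Finset (ℤ × ℤ)} (h : Rfl T) {s : ℤ × ℤ} (hs : s ∈ T) : s ≠ (0, 0) := by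
  rintro rfl; exact h.zero hs

/-- primitivity -/
lemma Rfl.prim {T : Finset (ℤ × ℤ)} (h : Rfl T) {s : ℤ × ℤ} (hs : s ∈ T) : IsCoprime s.1 s.2 := by
  rw [Int.isCoprime_iff_gcd_eq_one]
  have hne := h.ne hs
  obtain ⟨x, hx⟩ := Int.gcd_dvd_left s.1 s.2
  obtain ⟨y, hy⟩ := Int.gcd_dvd_right s.1 s.2
  set g : ℤ := (Int.gcd s.1 s.2 : ℤ) with hg
  have hg0 : 0 < g := by
    have : Int.gcd s.1 s.2 ≠ 0 := by
      intro h0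
      rw [Int.gcd_eq_zero_iff] at h0
      exact hne (Prod.ext h0.1 h0.2)
    omega
  have := h.le s hs s hs (x, y) (by
    intro h0
    simp only [Prod.mk.injEq] at h0
    apply hne
    ext <;> simp [hx, hy, h0]) g 1 0 hg0 (by norm_num) le_rfl (by simp [← hx]) (by simp [← hy])
  omega

lemma Rfl.pt {T : Finset (ℤ × ℤ)} (h : Rfl T) {s t : ℤ × ℤ} (hs : s ∈ T) (ht : t ∈ T) (e : ℤ)
    (he : e * e = 1) (hd : 0 < e * dt s t) :
    ∃ p ∈ T, e * dt s p = 1 ∧ 0 ≤ e * dt p t := by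
  obtain ⟨a, b, hab⟩ := h.prim hs
  -- w = e * (-b, a), dt s w = e
  set d := e * dt s t with hdd
  set c := e * dt (e * -b, e * a) t with hc
  set k := c / d with hk
  have hmod : c % d = c - d * k := by rw [hk]; have := Int.emod_add_mul_ediv c d; linarith
  have h0 := Int.emod_nonneg c hd.ne'
  have h1 := Int.emod_lt_of_pos c hd
  have key : dt s (e * -b - k * s.1, e * a - k * s.2) = e := by
    simp only [dt]; linear_combination e * hab
  have key2 : e * dt (e * -b - k * s.1, e * a - k * s.2) t = c % d := by
    rw [hmod, hc, hdd]; simp only [dt]; ring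
  refine ⟨(e * -b - k * s.1, e * a - k * s.2), ?_, by rw [key, he], by rw [key2]; exact h0⟩
  refine h.mem s hs t ht _ ?_ d (c % d) 1 hd h0 (by norm_num) ?_ ?_ (by omega)
  · intro h0
    rw [h0] at key
    simp only [dt] at key
    have : e = 0 := by linarith
    rw [this] at he; norm_num at he
  · rw [← key2, hdd]; simp only [dt] at key ⊢
    linear_combination (e * t.1) * key + t.1 * he
  · rw [← key2, hdd]; simp only [dt] at key ⊢
    linear_combination (e * t.2) * key + t.2 * he

lemma Rfl.par {T : Finset (ℤ × ℤ)} (h : Rfl T) {s q t : ℤ × ℤ} (hs : s ∈ T) (hq : q ∈ T)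
    (h0 : dt s q = 0) (h1 : 0 < dt s t) (h2 : 0 ≤ dt q t) : q = s := by
  have e1 : dt s t * q.1 = dt q t * s.1 := by
    simp only [dt] at *; linear_combination (t.1) * h0
  have e2 : dt s t * q.2 = dt q t * s.2 := by
    simp only [dt] at *; linear_combination (t.2) * h0
  have a1 := h.le s hs s hs q (h.ne hq) _ _ 0 h1 h2 le_rfl (by rw [e1]; ring) (by rw [e2]; ring)
  have a2 := h.le q hq q hq s (h.ne hs) (dt q t) (dt s t) 0 (by omega) (by omega) le_rfl
    (by rw [e1]; ring) (by rw [e2]; ring)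
  have e : dt s t = dt q t := by omega
  rw [← e] at e1 e2
  exact Prod.ext (mul_left_cancel₀ h1.ne' e1) (mul_left_cancel₀ h1.ne' e2)

lemma Rfl.par2 {T : Finset (ℤ × ℤ)} (h : Rfl T) {s q t : ℤ × ℤ} (ht : t ∈ T) (hq : q ∈ T)
    (h0 : dt q t = 0) (h1 : 0 < dt s t) (h2 : 0 ≤ dt s q) : q = t := by
  have e1 : dt s t * q.1 = dt s q * t.1 := by
    simp only [dt] at *; linear_combination (s.1) * h0
  have e2 : dt s t * q.2 = dt s q * t.2 := by
    simp only [dt] at *; linear_combination (s.2) * h0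
  have a1 := h.le t ht t ht q (h.ne hq) _ _ 0 h1 h2 le_rfl (by rw [e1]; ring) (by rw [e2]; ring)
  have a2 := h.le q hq q hq t (h.ne ht) (dt s q) (dt s t) 0 (by omega) (by omega) le_rfl
    (by rw [e1]; ring) (by rw [e2]; ring)
  have e : dt s t = dt s q := by omega
  rw [← e] at e1 e2
  exact Prod.ext (mul_left_cancel₀ h1.ne' e1) (mul_left_cancel₀ h1.ne' e2)

lemma dt_plucker (s q p t : ℤ × ℤ) : dt s q * dt p t = dt s p * dt q t + dt s t * dt p q := by
  simp only [dt]; ring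

lemma Rfl.consec_aux {T : Finset (ℤ × ℤ)} (h : Rfl T) (v : ℤ × ℤ) (n : ℕ) :
    ∀ s ∈ T, ∀ t ∈ T, (T.filter (fun q => 0 ≤ dt s q ∧ 0 ≤ dt q t)).card ≤ n →
      0 < dt s t → 0 ≤ dt s v → 0 ≤ dt v t →
    ∃ s ∈ T, ∃ t ∈ T, dt s t = 1 ∧ 0 ≤ dt s v ∧ 0 ≤ dt v t ∧
      ∀ q ∈ T, 0 ≤ dt s q → 0 ≤ dt q t → q = s ∨ q = t := by
  induction n with
  | zero =>
    intro s hs t ht hc h1 h2 h3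
    exfalso
    have : s ∈ (T.filter (fun q => 0 ≤ dt s q ∧ 0 ≤ dt q t)) := by
      simp only [Finset.mem_filter]
      exact ⟨hs, by simp [dt, mul_comm], h1.le⟩
    have := Finset.card_pos.2 ⟨s, this⟩
    omega
  | succ n ih =>
    intro s hs t ht hc h1 h2 h3
    have hss : ∀ s : ℤ × ℤ, dt s s = 0 := by intro s; simp only [dt]; ring
    have hsw : ∀ s t : ℤ × ℤ, dt s t = - dt t s := by intro s t; simp only [dt]; ring
    by_cases hq : ∃ q ∈ T, 0 ≤ dt s q ∧ 0 ≤ dt q t ∧ q ≠ s ∧ q ≠ t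
    · obtain ⟨q, hqT, q1, q2, q3, q4⟩ := hq
      have q1' : 0 < dt s q := lt_of_le_of_ne q1 (fun h0 => q3 (h.par hs hqT h0.symm h1 q2))
      have q2' : 0 < dt q t := lt_of_le_of_ne q2 (fun h0 => q4 (h.par2 ht hqT h0.symm h1 q1))
      rcases le_total 0 (dt v q) with hv | hv
      · apply ih s hs q hqT _ q1' h2 hv
        have : (T.filter (fun p => 0 ≤ dt s p ∧ 0 ≤ dt p q)) ⊂
            (T.filter (fun p => 0 ≤ dt s p ∧ 0 ≤ dt p t)) := by
          rw [Finset.ssubset_iff_of_subset]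
          · refine ⟨t, ?_, ?_⟩
            · simp [ht, h1.le, hss]
            · simp only [Finset.mem_filter, not_and, not_le]
              intro _ _; rw [hsw]; omega
          · intro p
            simp only [Finset.mem_filter]
            rintro ⟨p1, p2, p3⟩
            refine ⟨p1, p2, ?_⟩
            have := dt_plucker s q p t
            have : 0 ≤ dt s q * dt p t := by rw [this]; positivity
            exact nonneg_of_mul_nonneg_right this q1'
        have := Finset.card_lt_card this
        omega
      · have hv' : 0 ≤ dt q v := by rw [hsw]; omega
        apply ih q hqT t ht _ q2' hv' h3
        have : (T.filter (fun p => 0 ≤ dt q p ∧ 0 ≤ dt p t)) ⊂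
            (T.filter (fun p => 0 ≤ dt s p ∧ 0 ≤ dt p t)) := by
          rw [Finset.ssubset_iff_of_subset]
          · refine ⟨s, ?_, ?_⟩
            · simp [hs, h1.le, hss]
            · simp only [Finset.mem_filter, not_and, not_le]
              intro _ h5; rw [hsw] at h5; omega
          · intro p
            simp only [Finset.mem_filter]
            rintro ⟨p1, p2, p3⟩
            refine ⟨p1, ?_, p3⟩
            have e1 := dt_plucker s p q t
            have : 0 ≤ dt s p * dt q t := by rw [e1]; positivity
            exact nonneg_of_mul_nonneg_left this q2'
        have := Finset.card_lt_card this
        omega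
    · push Not at hq
      have hq' : ∀ q ∈ T, 0 ≤ dt s q → 0 ≤ dt q t → q = s ∨ q = t := by
        intro q a b c
        by_cases e : q = s
        · exact Or.inl e
        · exact Or.inr (hq q a b c e)
      refine ⟨s, hs, t, ht, ?_, h2, h3, hq'⟩
      obtain ⟨p, hp, p1, p2⟩ := h.pt hs ht 1 rfl (by simpa using h1)
      simp only [one_mul] at p1 p2
      rcases hq' p hp (by omega) p2 with rfl | rfl
      · rw [hss] at p1; omega
      · exact p1

lemma Rfl.cone {T : Finset (ℤ × ℤ)} (h : Rfl T) (v : ℤ × ℤ) (hv : v ≠ (0, 0)) :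
    ∃ s ∈ T, ∃ t ∈ T, 0 < dt s t ∧ 0 ≤ dt s v ∧ 0 ≤ dt v t := by
  obtain ⟨s0, hs0, hd0⟩ := h.span v hv
  obtain ⟨s, hs, hmax⟩ := Finset.exists_max_image (T.filter (fun s => 0 < dt v s))
    (fun s => (ip v s : ℚ) / (dt v s : ℚ)) ⟨s0, by simp [hs0, hd0]⟩
  simp only [Finset.mem_filter] at hs hmax
  obtain ⟨t, ht, hst⟩ := h.span (-s.1, -s.2) (by
    intro h0
    simp only [Prod.mk.injEq, neg_eq_zero] at h0
    exact h.ne hs.1 (Prod.ext h0.1 h0.2))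
  have hts : 0 < dt t s := by simp only [dt] at *; linarith
  refine ⟨t, ht, s, hs.1, hts, ?_, hs.2.le⟩
  by_contra hneg
  push Not at hneg
  have hvt : 0 < dt v t := by simp only [dt] at *; linarith
  have := hmax t ⟨ht, hvt⟩
  have c1 : (0:ℚ) < dt v s := by exact_mod_cast hs.2
  have c2 : (0:ℚ) < dt v t := by exact_mod_cast hvt
  rw [div_le_div_iff₀ c2 c1] at this
  have this : ip v t * dt v s ≤ ip v s * dt v t := by exact_mod_cast this
  have e : ip v t * dt v s - ip v s * dt v t = (v.1 ^ 2 + v.2 ^ 2) * dt t s := by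
    simp only [ip, dt]; ring
  have : 0 < v.1 ^ 2 + v.2 ^ 2 := by
    by_contra hle
    have a1 : v.1 = 0 := by nlinarith [sq_nonneg v.1, sq_nonneg v.2]
    have a2 : v.2 = 0 := by nlinarith [sq_nonneg v.1, sq_nonneg v.2]
    exact hv (Prod.ext a1 a2)
  have := mul_pos this hts
  linarith

lemma Rfl.consec {T : Finset (ℤ × ℤ)} (h : Rfl T) (v : ℤ × ℤ) (hv : v ≠ (0, 0)) :
    ∃ s ∈ T, ∃ t ∈ T, dt s t = 1 ∧ 0 ≤ dt s v ∧ 0 ≤ dt v t ∧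
      ∀ q ∈ T, 0 ≤ dt s q → 0 ≤ dt q t → q = s ∨ q = t := by
  obtain ⟨s, hs, t, ht, h1, h2, h3⟩ := h.cone v hv
  exact h.consec_aux v _ s hs t ht le_rfl h1 h2 h3

lemma dt_exp {s t : ℤ × ℤ} (h : dt s t = 1) (q : ℤ × ℤ) :
    q.1 = dt q t * s.1 + dt s q * t.1 ∧ q.2 = dt q t * s.2 + dt s q * t.2 := by
  simp only [dt] at *
  constructor
  · linear_combination (-q.1) * h
  · linear_combination (-q.2) * h

lemma Rfl.bidual {T : Finset (ℤ × ℤ)} (h : Rfl T) (v : ℤ × ℤ) (hv : v ≠ (0, 0))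
    (hb : ∀ u ∈ dualSet T, -1 ≤ ip u v) : v ∈ T := by
  obtain ⟨s, hs, t, ht, hd, h2, h3, hq⟩ := h.consec v hv
  by_contra hvT
  have hip : ∀ q, ip (-(t.2 - s.2), t.1 - s.1) q = - (dt q t + dt s q) := by
    intro q; simp only [ip, dt]; ring
  have hu : (-(t.2 - s.2), t.1 - s.1) ∈ dualSet T := by
    refine ⟨?_, ?_⟩
    · intro h0
      have := hip s
      rw [h0, hd] at this
      simp [ip, dt, mul_comm] at this
    · intro q hqT
      rw [hip]
      by_contra hlt
      obtain ⟨e1, e2⟩ := dt_exp hd q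
      by_cases a : 0 ≤ dt s q
      · by_cases b : 0 ≤ dt q t
        · rcases hq q hqT a b with rfl | rfl
          · simp [dt, mul_comm] at hd hlt; omega
          · simp [dt, mul_comm] at hd hlt; omega
        · have := h.le q hqT s hs t (h.ne ht) (dt s q) 1 (- dt q t) (by omega) (by omega) (by omega)
            (by linarith) (by linarith)
          omega
      · have := h.le q hqT t ht s (h.ne hs) (dt q t) 1 (- dt s q) (by omega) (by omega) (by omega)
            (by linarith) (by linarith)
        omega
  have := hb _ hu
  rw [hip] at this
  obtain ⟨e1, e2⟩ := dt_exp hd v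
  have hc : (dt v t = 0 ∧ dt s v = 0) ∨ (dt v t = 1 ∧ dt s v = 0) ∨ (dt v t = 0 ∧ dt s v = 1) := by
    omega
  rcases hc with ⟨a, b⟩ | ⟨a, b⟩ | ⟨a, b⟩ <;> rw [a, b] at e1 e2
  · exact hv (Prod.ext (by linarith) (by linarith))
  · apply hvT; convert hs using 1; exact Prod.ext (by linarith) (by linarith)
  · apply hvT; convert ht using 1; exact Prod.ext (by linarith) (by linarith)

def Pat (T : Finset (ℤ × ℤ)) (a b : ℤ × ℤ) : Prop :=
  a ∈ T ∧ b ∈ T ∧ ((-a.1 - b.1, -a.2 - b.2) ∈ T ∨ (-a.1 - 2 * b.1, -a.2 - 2 * b.2) ∈ T ∨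
      ((-a.1, -a.2) ∈ T ∧ (-b.1, -b.2) ∈ T))

lemma Rfl.pat1 {T : Finset (ℤ × ℤ)} (h : Rfl T) {s : ℤ × ℤ} (hs : s ∈ T)
    (hs' : (-s.1, -s.2) ∈ T) : ∃ a b, dt a b * dt a b = 1 ∧ Pat T a b := by
  obtain ⟨t0, ht0, h0⟩ := h.span s (h.ne hs)
  obtain ⟨t, ht, h1, -⟩ := h.pt hs ht0 1 rfl (by simpa using h0)
  obtain ⟨r0, hr0, h0'⟩ := h.span _ (h.ne hs')
  obtain ⟨r, hr, h2, -⟩ := h.pt hs hr0 (-1) rfl (by simp only [dt] at *; linarith)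
  obtain ⟨m, hm⟩ : ∃ m, m = dt r t := ⟨_, rfl⟩
  have h1 : dt s t = 1 := by linarith
  have h2 : dt s r = -1 := by linarith
  obtain ⟨e1, e2⟩ := dt_exp h1 r
  rw [← hm, h2] at e1 e2
  have u1 : m ≤ 2 := by
    by_contra hc
    have := h.le r hr t ht s (h.ne hs) m 1 1 (by omega) (by omega) (by omega) (by linarith) (by linarith)
    omega
  have u2 : -2 ≤ m := by
    by_contra hc
    have := h.le r hr t ht _ (h.ne hs') (-m) 1 1 (by omega) (by omega) (by omega)
      (by simp only; linarith) (by simp only; linarith)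
    omega
  have hm5 : m = -2 ∨ m = -1 ∨ m = 0 ∨ m = 1 ∨ m = 2 := by omega
  rcases hm5 with hm | hm | hm | hm | hm <;> rw [hm] at e1 e2
  · refine ⟨t, s, by simp only [dt] at *; nlinarith, ht, hs, Or.inr (Or.inl ?_)⟩
    convert hr using 1; exact Prod.ext (by simp only; linarith) (by simp only; linarith)
  · refine ⟨s, t, by simp [h1], hs, ht, Or.inl ?_⟩
    convert hr using 1; exact Prod.ext (by simp only; linarith) (by simp only; linarith)
  · refine ⟨s, t, by simp [h1], hs, ht, Or.inr (Or.inr ⟨hs', ?_⟩)⟩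
    convert hr using 1; exact Prod.ext (by simp only; linarith) (by simp only; linarith)
  · refine ⟨_, t, ?_, hs', ht, Or.inl ?_⟩
    · simp only [dt] at *; nlinarith
    convert hr using 1; exact Prod.ext (by simp only; linarith) (by simp only; linarith)
  · refine ⟨t, _, ?_, ht, hs', Or.inr (Or.inl ?_)⟩
    · simp only [dt] at *; nlinarith
    convert hr using 1; exact Prod.ext (by simp only; linarith) (by simp only; linarith)

lemma neg_ne {s : ℤ × ℤ} (hs : s ≠ (0, 0)) : (-s.1, -s.2) ≠ ((0, 0) : ℤ × ℤ) := by
  intro h0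
  simp only [Prod.mk.injEq, neg_eq_zero] at h0
  exact hs (Prod.ext h0.1 h0.2)

lemma Rfl.pat {T : Finset (ℤ × ℤ)} (h : Rfl T) : ∃ a b, dt a b * dt a b = 1 ∧ Pat T a b := by
  obtain ⟨s, hs, -⟩ := h.span (1, 0) (by simp)
  have hn := neg_ne (h.ne hs)
  obtain ⟨t, ht, r, hr, hd, ha, hb, -⟩ := h.consec _ hn
  obtain ⟨e1, e2⟩ := dt_exp hd (-s.1, -s.2)
  generalize dt (-s.1, -s.2) r = a at *
  generalize dt t (-s.1, -s.2) = b at *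
  simp only at e1 e2
  rcases lt_trichotomy a b with hab | hab | hab
  · exact h.pat1 hr (h.mem s hs t ht _ (neg_ne (h.ne hr)) b 1 a (by omega) (by omega) (by omega)
      (by simp only; linarith) (by simp only; linarith) (by omega))
  · subst hab
    have ha0 : a ≠ 0 := by
      rintro rfl
      exact hn (Prod.ext (by simp only; linarith) (by simp only; linarith))
    refine ⟨t, r, by simp [hd], ht, hr, Or.inl ?_⟩
    refine h.mem s hs s hs _ ?_ a 1 0 (by omega) (by omega) (by omega)
      (by simp only; linarith) (by simp only; linarith) (by omega)
    intro h0
    simp only [Prod.mk.injEq] at h0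
    simp only [dt] at hd
    have : t.1 = -r.1 := by linarith
    have h' : t.2 = -r.2 := by linarith
    rw [this, h'] at hd
    ring_nf at hd
    omega
  · exact h.pat1 ht (h.mem s hs r hr _ (neg_ne (h.ne ht)) a 1 b (by omega) (by omega) (by omega)
      (by simp only; linarith) (by simp only; linarith) (by omega))

lemma Rfl.transport {T : Finset (ℤ × ℤ)} (h : Rfl T) (a b : ℤ × ℤ) (hd : dt a b * dt a b = 1)
    (hp : Pat T a b) : ∃ T' : Finset (ℤ × ℤ), Rfl T' ∧ Pat T' (1, 0) (0, 1) ∧ T'.card = T.card ∧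
      (dualSet T').ncard = (dualSet T).ncard := by
  obtain ⟨e, he⟩ : ∃ e, e = dt a b := ⟨_, rfl⟩
  rw [← he] at hd
  let φ : ℤ × ℤ → ℤ × ℤ := fun q => (q.1 * a.1 + q.2 * b.1, q.1 * a.2 + q.2 * b.2)
  let ψ : ℤ × ℤ → ℤ × ℤ := fun p => (e * dt p b, e * dt a p)
  have h1 : ∀ q, φ (ψ q) = q := by
    intro q
    simp only [φ, ψ]
    ext
    · simp only [dt] at *; linear_combination (-e * q.1) * he + q.1 * hd
    · simp only [dt] at *; linear_combination (-e * q.2) * he + q.2 * hd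
  have h2 : ∀ q, ψ (φ q) = q := by
    intro q
    simp only [φ, ψ]
    ext
    · simp only [dt] at *; linear_combination (-e * q.1) * he + q.1 * hd
    · simp only [dt] at *; linear_combination (-e * q.2) * he + q.2 * hd
  have hm : ∀ q, q ∈ T.image ψ ↔ φ q ∈ T := by
    intro q
    rw [Finset.mem_image]
    constructor
    · rintro ⟨p, hp, rfl⟩; rwa [h1]
    · intro hq; exact ⟨_, hq, h2 q⟩
  have hφ0 : ∀ q, q ≠ (0, 0) → φ q ≠ (0, 0) := by
    intro q hq h0
    apply hq
    rw [← h2 q, h0]; simp [ψ, dt]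
  have hdt : ∀ p q, dt (φ p) (φ q) = e * dt p q := by
    intro p q; simp only [φ, he, dt]; ring
  refine ⟨T.image ψ, ⟨?_, ?_, ?_, ?_⟩, ?_, ?_, ?_⟩
  · rw [hm]; simp only [φ]; simpa using h.zero
  · intro s hs t ht p hp n x y hn hx hy q1 q2 hle
    rw [hm] at *
    refine h.mem _ hs _ ht _ (hφ0 p hp) n x y hn hx hy ?_ ?_ hle
    · simp only [φ]; linear_combination a.1 * q1 + b.1 * q2
    · simp only [φ]; linear_combination a.2 * q1 + b.2 * q2
  · intro s hs t ht p hp n x y hn hx hy q1 q2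
    rw [hm] at *
    refine h.le _ hs _ ht _ (hφ0 p hp) n x y hn hx hy ?_ ?_
    · simp only [φ]; linear_combination a.1 * q1 + b.1 * q2
    · simp only [φ]; linear_combination a.2 * q1 + b.2 * q2
  · intro v hv
    have e0 : e ≠ 0 := by rintro rfl; simp at hd
    obtain ⟨s, hs, hlt⟩ := h.span (φ (e * v.1, e * v.2)) (hφ0 _ (by
      intro h0
      simp only [Prod.mk.injEq, mul_eq_zero, e0, false_or] at h0
      exact hv (Prod.ext h0.1 h0.2)))
    refine ⟨ψ s, by rw [hm, h1]; exact hs, ?_⟩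
    rw [← h1 s, hdt] at hlt
    have : e * dt (e * v.1, e * v.2) (ψ s) = (e * e) * dt v (ψ s) := by
      simp only [dt]; ring
    rw [this, hd] at hlt
    linarith
  · obtain ⟨p1, p2, p3⟩ := hp
    unfold Pat
    simp only [hm]
    have f1 : φ (1, 0) = a := by simp [φ]
    have f2 : φ (0, 1) = b := by simp [φ]
    have f3 : φ (-1 - 0, -0 - 1) = (-a.1 - b.1, -a.2 - b.2) := by
      simp only [φ]; ext <;> ring
    have f4 : φ (-1 - 2 * 0, -0 - 2 * 1) = (-a.1 - 2 * b.1, -a.2 - 2 * b.2) := by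
      simp only [φ]; ext <;> ring
    have f5 : φ (-1, -0) = (-a.1, -a.2) := by
      simp only [φ]; ext <;> ring
    have f6 : φ (-0, -1) = (-b.1, -b.2) := by
      simp only [φ]; ext <;> ring
    rw [f1, f2, f3, f4, f5, f6]
    exact ⟨p1, p2, p3⟩
  · apply Finset.card_image_of_injective
    intro p q hpq
    rw [← h1 p, hpq, h1]
  · let χ : ℤ × ℤ → ℤ × ℤ := fun u => (ip u a, ip u b)
    let ξ : ℤ × ℤ → ℤ × ℤ := fun w => (e * (w.1 * b.2 - w.2 * a.2), e * (w.2 * a.1 - w.1 * b.1))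
    have k1 : ∀ q, χ (ξ q) = q := by
      intro q
      simp only [χ, ξ]
      ext
      · simp only [dt, ip] at *; linear_combination (-e * q.1) * he + q.1 * hd
      · simp only [dt, ip] at *; linear_combination (-e * q.2) * he + q.2 * hd
    have k2 : ∀ q, ξ (χ q) = q := by
      intro q
      simp only [χ, ξ]
      ext
      · simp only [dt, ip] at *; linear_combination (-e * q.1) * he + q.1 * hd
      · simp only [dt, ip] at *; linear_combination (-e * q.2) * he + q.2 * hd
    have k3 : ∀ u q, ip (χ u) q = ip u (φ q) := by
      intro u q; simp only [χ, φ, ip]; ring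
    have k0 : ∀ u, χ u = (0, 0) ↔ u = (0, 0) := by
      intro u
      constructor
      · intro h0; rw [← k2 u, h0]; simp [ξ]
      · rintro rfl; simp [χ, ip]
    have : dualSet (T.image ψ) = χ '' dualSet T := by
      ext w
      constructor
      · rintro ⟨w1, w2⟩
        refine ⟨ξ w, ⟨?_, ?_⟩, k1 w⟩
        · rw [Ne, ← k0, k1]; exact w1
        · intro t ht
          rw [← h1 t, ← k3, k1]
          apply w2
          rw [hm, h1]; exact ht
      · rintro ⟨u, ⟨u1, u2⟩, rfl⟩
        refine ⟨by rwa [Ne, k0], ?_⟩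
        intro t ht
        rw [k3]
        exact u2 _ ((hm t).1 ht)
    rw [this]
    apply Set.ncard_image_of_injective
    intro p q hpq
    rw [← k2 p, hpq, k2]

/-- the relevant inequality for a combination -/
lemma Rfl.bd {T : Finset (ℤ × ℤ)} (h : Rfl T) {x y : ℤ} (hv : (x, y) ∈ T) {c : ℤ × ℤ} (hc : c ∈ T)
    (p : ℤ × ℤ) (hp : p ≠ (0, 0)) (n b : ℤ) (e1 : n * p.1 = x + b * c.1)
    (e2 : n * p.2 = y + b * c.2) : 0 < n → 0 ≤ b → n ≤ 1 + b := by
  intro hn hb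
  exact h.le _ hv _ hc p hp n 1 b hn (by norm_num) hb (by simpa using e1) (by simpa using e2)

def rng : List ℤ := [-5, -4, -3, -2, -1, 0, 1, 2, 3, 4, 5]
def bx : List (ℤ × ℤ) := (rng.product rng).filter (fun p => !(p.1 == 0 && p.2 == 0))
def ok (u p : ℤ × ℤ) : Bool := decide (-1 ≤ u.1 * p.1 + u.2 * p.2)
def ts (D : List (ℤ × ℤ)) : List (ℤ × ℤ) := bx.filter (fun p => D.all (fun u => ok u p))
def chk (L D : List (ℤ × ℤ)) : Bool :=
  (fun t : List (ℤ × ℤ) =>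
  !(t.all (fun p => !(D.all (fun u => ok u (2 * p.1, 2 * p.2)))))
    || !(decide (L.filter (fun u => t.all (fun p => ok u p)) = D))
    || decide (D.length + t.length = 12)) (ts D)

def L1 : List (ℤ × ℤ) :=
  [(-1, -1), (-1, 0), (-1, 1), (-1, 2), (0, -1), (0, 1), (1, -1), (1, 0), (2, -1)]
def L2 : List (ℤ × ℤ) :=
  [(-1, -1), (-1, 0), (-1, 1), (0, -1), (1, -1), (1, 0), (2, -1), (3, -1)]
def L3 : List (ℤ × ℤ) :=
  [(-1, -1), (-1, 0), (-1, 1), (0, -1), (0, 1), (1, -1), (1, 0), (1, 1)]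

set_option maxRecDepth 100000 in
lemma chk1 : L1.sublists.all (chk L1) = true := by decide +kernel
set_option maxRecDepth 100000 in
lemma chk2 : L2.sublists.all (chk L2) = true := by decide +kernel
set_option maxRecDepth 100000 in
lemma chk3 : L3.sublists.all (chk L3) = true := by decide +kernel

lemma mem_bx (p : ℤ × ℤ) : p ∈ bx ↔ p ≠ (0, 0) ∧ (-5 ≤ p.1 ∧ p.1 ≤ 5) ∧ (-5 ≤ p.2 ∧ p.2 ≤ 5) := by
  have hr : ∀ x : ℤ, x ∈ rng ↔ -5 ≤ x ∧ x ≤ 5 := by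
    intro x; simp only [rng, List.mem_cons, List.not_mem_nil, or_false]; omega
  obtain ⟨x, y⟩ := p
  rw [bx, List.mem_filter, List.pair_mem_product, hr, hr]
  simp
  tauto

lemma bx_nodup : bx.Nodup := by decide +kernel

lemma Rfl.finish {T : Finset (ℤ × ℤ)} (h : Rfl T) (L : List (ℤ × ℤ)) (hL : L.Nodup)
    (hc : L.sublists.all (chk L) = true) (hb : ∀ v ∈ T, v ∈ bx) (h0 : (0, 0) ∉ L)
    (hD : ∀ u ∈ dualSet T, u ∈ L) : T.card + (dualSet T).ncard = 12 := by
  classical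
  let D := L.filter (fun u => decide (∀ t ∈ T, -1 ≤ ip u t))
  have hDm : ∀ u, u ∈ D ↔ u ∈ dualSet T := by
    intro u
    simp only [D, List.mem_filter, decide_eq_true_eq]
    constructor
    · rintro ⟨a, b⟩
      exact ⟨fun e => h0 (e ▸ a), b⟩
    · intro hu; exact ⟨hD u hu, hu.2⟩
  have hok : ∀ u p, ok u p = true ↔ -1 ≤ ip u p := by
    intro u p; simp [ok, ip]
  have hall : ∀ p, (D.all (fun u => ok u p)) = true ↔ ∀ u ∈ dualSet T, -1 ≤ ip u p := by
    intro p
    simp only [List.all_eq_true, hDm, hok]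
  have hT : ∀ p, p ∈ ts D ↔ p ∈ T := by
    intro p
    rw [ts, List.mem_filter, hall]
    constructor
    · rintro ⟨a, b⟩
      exact h.bidual p ((mem_bx p).1 a).1 b
    · intro hp
      exact ⟨hb p hp, fun u hu => hu.2 p hp⟩
  have hTn : (ts D).Nodup := bx_nodup.filter _
  have hDn : D.Nodup := hL.filter _
  have c1 : T.card = (ts D).length := by
    rw [← List.toFinset_card_of_nodup hTn]
    congr 1
    ext p; simp [hT]
  have c2 : (dualSet T).ncard = D.length := by
    rw [← List.toFinset_card_of_nodup hDn, ← Set.ncard_coe_finset]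
    congr 1
    ext p; simp [hDm]
  rw [List.all_eq_true] at hc
  have := hc D (by rw [List.mem_sublists]; exact List.filter_sublist)
  simp only [chk, Bool.or_eq_true, Bool.not_eq_true', decide_eq_true_eq, decide_eq_false_iff_not] at this
  rcases this with (h1 | h2) | h3
  · exfalso
    rw [← Bool.not_eq_true, List.all_eq_true] at h1
    apply h1
    intro p hp
    rw [hT] at hp
    rw [Bool.not_eq_true', ← Bool.not_eq_true, hall]
    intro hall2
    have hpn := h.ne hp
    have h2p : ((2 * p.1, 2 * p.2) : ℤ × ℤ) ∈ T := h.bidual _ (by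
      intro h0
      simp only [Prod.mk.injEq] at h0
      exact hpn (Prod.ext (by simp only; omega) (by simp only; omega))) hall2
    have := h.le _ h2p _ h2p p hpn 2 1 0 (by norm_num) (by norm_num) le_rfl (by simp) (by simp)
    omega
  · exfalso
    apply h2
    apply List.filter_congr
    intro u hu
    rw [Bool.eq_iff_iff, List.all_eq_true, decide_eq_true_eq]
    simp only [hT, hok]
  · omega

lemma Rfl.tri {T : Finset (ℤ × ℤ)} (h : Rfl T) {v : ℤ × ℤ} (hv : v ∈ T) {a b : ℤ × ℤ} (x y : ℤ)
    (hb : b ∈ T) (hc : (-a.1 - b.1, -a.2 - b.2) ∈ T) (ha : a ∈ T)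
    (e1 : v.1 = x * a.1 + y * b.1) (e2 : v.2 = x * a.2 + y * b.2) (h1 : 0 ≤ y) (h2 : y ≤ x) :
    y ≤ 1 ∧ x ≤ 3 := by
  have k1 : y ≤ 1 := by
    by_contra hh
    have := h.bd (x := v.1) (y := v.2) hv hb _ (neg_ne (h.ne hc)) x (x - y) (by simp only; linarith)
      (by simp only; linarith) (by omega) (by omega)
    omega
  refine ⟨k1, ?_⟩
  by_contra hh
  have := h.bd (x := v.1) (y := v.2) hv hc a (h.ne ha) (x - y) y (by simp only; linarith)
      (by simp only; linarith) (by omega) (by omega)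
  omega

lemma Rfl.quad {T : Finset (ℤ × ℤ)} (h : Rfl T) {v : ℤ × ℤ} (hv : v ∈ T) (a b : ℤ × ℤ) (x y : ℤ)
    (hb : b ∈ T) (hc : (-b.1, -b.2) ∈ T) (ha : a ∈ T) (hab : (a.1 + b.1, a.2 + b.2) ≠ (0, 0))
    (e1 : v.1 = x * a.1 + y * b.1) (e2 : v.2 = x * a.2 + y * b.2) (h1 : 0 ≤ y) (h2 : y ≤ x) :
    y ≤ 1 ∧ x ≤ 2 := by
  have k1 : y ≤ 1 := by
    by_contra hh
    have := h.bd (x := v.1) (y := v.2) hv hb _ hab x (x - y) (by simp only; linarith)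
      (by simp only; linarith) (by omega) (by omega)
    omega
  refine ⟨k1, ?_⟩
  by_contra hh
  have := h.bd (x := v.1) (y := v.2) hv hc a (h.ne ha) x y (by simp only; linarith)
      (by simp only; linarith) (by omega) (by omega)
  omega

lemma Rfl.half {T : Finset (ℤ × ℤ)} (h : Rfl T) {v : ℤ × ℤ} (hv : v ∈ T) (a b : ℤ × ℤ) (x y : ℤ)
    (hb : b ∈ T) (hc : (-b.1, -b.2) ∈ T) (ha : a ∈ T) (hab : (a.1 + b.1, a.2 + b.2) ≠ (0, 0))
    (hab' : (a.1 - b.1, a.2 - b.2) ≠ (0, 0)) (hd : (-a.1 - 2 * b.1, -a.2 - 2 * b.2) ∈ T)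
    (e1 : v.1 = x * a.1 + y * b.1) (e2 : v.2 = x * a.2 + y * b.2) (hx : 0 ≤ x) :
    x ≤ 2 ∧ -1 ≤ y ∧ y ≤ 4 ∧ (x = 2 → y ≤ 1) := by
  have k1 : -1 ≤ y := by
    by_contra hh
    have i1 := h.bd (x := v.1) (y := v.2) hv hd _ (h.ne hc) (2 * x - y) x (by simp only; linarith)
      (by simp only; linarith) (by omega) (by omega)
    have i2 := h.bd (x := v.1) (y := v.2) hv hb _ hab' x (x + y) (by simp only; linarith)
      (by simp only; linarith) (by omega) (by omega)
    omega
  by_cases hyx : y ≤ x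
  · by_cases hy : 0 ≤ y
    · have := h.quad hv a b x y hb hc ha hab e1 e2 hy hyx
      omega
    · have hy : y = -1 := by omega
      subst hy
      by_cases hx3 : x ≤ 2
      · omega
      have := h.bd (x := v.1) (y := v.2) hv hb a (h.ne ha) x 1 (by linarith)
        (by linarith) (by omega) (by omega)
      omega
  · have i1 : x ≤ 1 := by
      have := h.bd (x := v.1) (y := v.2) hv ha _ hab y (y - x) (by simp only; linarith)
        (by simp only; linarith) (by omega) (by omega)
      omega
    by_cases hh : 0 < y - 2 * x
    · have := h.bd (x := v.1) (y := v.2) hv hd b (h.ne hb) (y - 2 * x) x (by simp only; linarith)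
        (by simp only; linarith) (by omega) (by omega)
      omega
    · omega

lemma Rfl.std1 {T : Finset (ℤ × ℤ)} (h : Rfl T) (ha : (1, 0) ∈ T) (hb : (0, 1) ∈ T)
    (hc : (-1, -1) ∈ T) : ∀ v ∈ T, v ∈ bx := by
  rintro ⟨x, y⟩ hv
  rw [mem_bx]
  refine ⟨h.ne hv, ?_⟩
  simp only
  rcases le_total 0 x with hx | hx <;> rcases le_total 0 y with hy | hy <;>
    rcases le_total x y with hxy | hxy
  · have := h.tri hv y x ha (by simpa using hc) hb (by simp) (by simp) hx hxy; omega
  · have := h.tri hv x y hb (by simpa using hc) ha (by simp) (by simp) hy hxy; omega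
  · omega
  · rcases le_total (x - y) (-y) with h3 | h3
    · have := h.tri hv (-y) (x - y) ha (by simpa using hb) hc (by simp) (by simp) (by omega) h3
      omega
    · have := h.tri hv (x - y) (-y) hc (by simpa using hb) ha (by simp) (by simp) (by omega) h3
      omega
  · rcases le_total (y - x) (-x) with h3 | h3
    · have := h.tri hv (-x) (y - x) hb (by simpa using ha) hc (by simp) (by simp) (by omega) h3
      omega
    · have := h.tri hv (y - x) (-x) hc (by simpa using ha) hb (by simp) (by simp) (by omega) h3
      omega
  · omega
  · rcases le_total (y - x) (-x) with h3 | h3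
    · have := h.tri hv (-x) (y - x) hb (by simpa using ha) hc (by simp) (by simp) (by omega) h3
      omega
    · have := h.tri hv (y - x) (-x) hc (by simpa using ha) hb (by simp) (by simp) (by omega) h3
      omega
  · rcases le_total (x - y) (-y) with h3 | h3
    · have := h.tri hv (-y) (x - y) ha (by simpa using hb) hc (by simp) (by simp) (by omega) h3
      omega
    · have := h.tri hv (x - y) (-y) hc (by simpa using hb) ha (by simp) (by simp) (by omega) h3
      omega

lemma Rfl.std2 {T : Finset (ℤ × ℤ)} (h : Rfl T) (ha : (1, 0) ∈ T) (hb : (0, 1) ∈ T)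
    (hc : (-1, -2) ∈ T) (hd : (0, -1) ∈ T) : ∀ v ∈ T, v ∈ bx := by
  rintro ⟨x, y⟩ hv
  rw [mem_bx]
  refine ⟨h.ne hv, ?_⟩
  simp only
  rcases le_total 0 x with hx | hx
  · have := h.half hv (1, 0) (0, 1) x y hb (by simpa using hd) ha (by simp) (by simp)
      (by simpa using hc) (by simp) (by simp) hx
    omega
  · have := h.half hv (-1, -2) (0, 1) (-x) (y - 2 * x) hb (by simpa using hd) hc (by simp) (by simp)
      (by simpa using ha) (by simp) (by simp only; ring) (by omega)
    omega

lemma Rfl.std3 {T : Finset (ℤ × ℤ)} (h : Rfl T) (ha : (1, 0) ∈ T) (hb : (0, 1) ∈ T)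
    (hc : (-1, 0) ∈ T) (hd : (0, -1) ∈ T) : ∀ v ∈ T, v ∈ bx := by
  rintro ⟨x, y⟩ hv
  rw [mem_bx]
  refine ⟨h.ne hv, ?_⟩
  simp only
  rcases le_total 0 x with hx | hx <;> rcases le_total 0 y with hy | hy
  · rcases le_total x y with h3 | h3
    · have := h.quad hv (0, 1) (1, 0) y x ha (by simpa using hc) hb (by simp) (by simp) (by simp)
        (by omega) (by omega)
      omega
    · have := h.quad hv (1, 0) (0, 1) x y hb (by simpa using hd) ha (by simp) (by simp) (by simp)
        (by omega) (by omega)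
      omega
  · rcases le_total x (-y) with h3 | h3
    · have := h.quad hv (0, -1) (1, 0) (-y) x ha (by simpa using hc) hd (by simp) (by simp) (by simp)
        (by omega) (by omega)
      omega
    · have := h.quad hv (1, 0) (0, -1) x (-y) hd (by simpa using hb) ha (by simp) (by simp) (by simp)
        (by omega) (by omega)
      omega
  · rcases le_total (-x) y with h3 | h3
    · have := h.quad hv (0, 1) (-1, 0) y (-x) hc (by simpa using ha) hb (by simp) (by simp) (by simp)
        (by omega) (by omega)
      omega
    · have := h.quad hv (-1, 0) (0, 1) (-x) y hb (by simpa using hd) hc (by simp) (by simp) (by simp)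
        (by omega) (by omega)
      omega
  · rcases le_total (-x) (-y) with h3 | h3
    · have := h.quad hv (0, -1) (-1, 0) (-y) (-x) hc (by simpa using ha) hd (by simp) (by simp)
        (by simp) (by omega) (by omega)
      omega
    · have := h.quad hv (-1, 0) (0, -1) (-x) (-y) hd (by simpa using hb) hc (by simp) (by simp)
        (by simp) (by omega) (by omega)
      omega

lemma Rfl.std {T : Finset (ℤ × ℤ)} (h : Rfl T) (hp : Pat T (1, 0) (0, 1)) :
    T.card + (dualSet T).ncard = 12 := by
  obtain ⟨ha, hb, hc⟩ := hp
  simp only at hc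
  norm_num at hc
  rcases hc with hc | hc | ⟨hc, hd⟩
  · refine h.finish L1 (by decide) chk1 (h.std1 ha hb hc) (by decide) ?_
    rintro ⟨x, y⟩ ⟨hu, hd⟩
    have j1 := hd _ ha
    have j2 := hd _ hb
    have j3 := hd _ hc
    simp only [ip] at j1 j2 j3
    have hu' : ¬ (x = 0 ∧ y = 0) := by simpa using hu
    simp only [L1, List.mem_cons, List.not_mem_nil, or_false, Prod.mk.injEq]
    have : -1 ≤ x ∧ x ≤ 2 := by omega
    obtain ⟨k1, k2⟩ := this
    interval_cases x <;> omega
  · have hd : (0, -1) ∈ T := h.mem _ ha _ hc _ (by simp) 2 1 1 (by norm_num) (by norm_num)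
      (by norm_num) (by norm_num) (by norm_num) (by norm_num)
    refine h.finish L2 (by decide) chk2 (h.std2 ha hb hc hd) (by decide) ?_
    rintro ⟨x, y⟩ ⟨hu, hd'⟩
    have j1 := hd' _ ha
    have j2 := hd' _ hb
    have j3 := hd' _ hc
    have j4 := hd' _ hd
    simp only [ip] at j1 j2 j3 j4
    have hu' : ¬ (x = 0 ∧ y = 0) := by simpa using hu
    simp only [L2, List.mem_cons, List.not_mem_nil, or_false, Prod.mk.injEq]
    have : -1 ≤ x ∧ x ≤ 3 := by omega
    obtain ⟨k1, k2⟩ := this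
    interval_cases x <;> omega
  · refine h.finish L3 (by decide) chk3 (h.std3 ha hb hc hd) (by decide) ?_
    rintro ⟨x, y⟩ ⟨hu, hd'⟩
    have j1 := hd' _ ha
    have j2 := hd' _ hb
    have j3 := hd' _ hc
    have j4 := hd' _ hd
    simp only [ip] at j1 j2 j3 j4
    have hu' : ¬ (x = 0 ∧ y = 0) := by simpa using hu
    simp only [L3, List.mem_cons, List.not_mem_nil, or_false, Prod.mk.injEq]
    have : -1 ≤ x ∧ x ≤ 1 := by omega
    obtain ⟨k1, k2⟩ := this
    interval_cases x <;> omega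

theorem Rfl.main {T : Finset (ℤ × ℤ)} (h : Rfl T) : T.card + (dualSet T).ncard = 12 := by
  obtain ⟨a, b, hd, hp⟩ := h.pat
  obtain ⟨T', h', hp', e1, e2⟩ := h.transport a b hd hp
  rw [← e1, ← e2]
  exact h'.std hp'

lemma toR_inj : Function.Injective toR := by
  rintro ⟨a, b⟩ ⟨c, d⟩ h
  simp only [toR, Prod.mk.injEq, Int.cast_inj] at h
  exact Prod.ext h.1 h.2

lemma lattice_finite {P : Set (ℝ × ℝ)} (hb : Bornology.IsBounded P) :
    {p : ℤ × ℤ | toR p ∈ P}.Finite := by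
  obtain ⟨R, hR⟩ := hb.exists_norm_le
  obtain ⟨N, hN⟩ := exists_nat_ge R
  apply (Set.finite_Icc ((-N, -N) : ℤ × ℤ) (N, N)).subset
  rintro ⟨x, y⟩ hp
  have h1 := hR _ hp
  have h2 : ‖(x:ℝ)‖ ≤ N := ((norm_fst_le (toR (x, y))).trans h1).trans hN
  have h3 : ‖(y:ℝ)‖ ≤ N := ((norm_snd_le (toR (x, y))).trans h1).trans hN
  rw [Real.norm_eq_abs, abs_le] at h2 h3
  obtain ⟨a1, a2⟩ := h2
  obtain ⟨b1, b2⟩ := h3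
  refine ⟨⟨?_, ?_⟩, ⟨?_, ?_⟩⟩ <;> simp only
  · exact_mod_cast a1
  · exact_mod_cast b1
  · exact_mod_cast a2
  · exact_mod_cast b2

theorem stmt12 (S : Finset (ℤ × ℤ)) (P : Set (ℝ × ℝ))
    (hP : P = convexHull ℝ (toR '' (S : Set (ℤ × ℤ))))
    (hint : {p : ℤ × ℤ | toR p ∈ interior P} = {(0, 0)})
    (Pd : Set (ℝ × ℝ))
    (hPd : Pd = {u : ℝ × ℝ | ∀ x ∈ P, -1 ≤ u.1 * x.1 + u.2 * x.2}) :
    {p : ℤ × ℤ | toR p ∈ frontier P}.ncard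
      + {p : ℤ × ℤ | toR p ∈ frontier Pd}.ncard = 12 := by
  have hcomp : IsCompact P := by
    rw [hP]
    exact (S.finite_toSet.image toR).isCompact_convexHull ℝ
  have hconv : Convex ℝ P := by rw [hP]; exact convex_convexHull ℝ _
  have hSP : ∀ s ∈ S, toR s ∈ P := by
    intro s hs
    rw [hP]; exact subset_convexHull ℝ _ ⟨s, hs, rfl⟩
  have hfin := lattice_finite hcomp.isBounded
  have hz : toR (0, 0) = 0 := by simp [toR]
  have h0i : (0 : ℝ × ℝ) ∈ interior P := by
    have : ((0, 0) : ℤ × ℤ) ∈ {p : ℤ × ℤ | toR p ∈ interior P} := by rw [hint]; rfl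
    rw [← hz]; exact this
  have h0P := interior_subset h0i
  have huniq : ∀ p, toR p ∈ interior P → p = (0, 0) := by
    intro p hp
    have : p ∈ {p : ℤ × ℤ | toR p ∈ interior P} := hp
    rw [hint] at this; exact this
  let T : Finset (ℤ × ℤ) := hfin.toFinset.erase (0, 0)
  have hT : ∀ p, p ∈ T ↔ p ≠ (0, 0) ∧ toR p ∈ P := by
    intro p; simp [T]
  -- any real functional nonzero is negative somewhere on T
  have hlin : ∀ a b : ℝ, (a ≠ 0 ∨ b ≠ 0) → ∃ s ∈ T, a * (s.1 : ℝ) + b * (s.2 : ℝ) < 0 := by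
    intro a b hab
    by_contra hcon
    push Not at hcon
    have hsub : P ⊆ {x : ℝ × ℝ | 0 ≤ a * x.1 + b * x.2} := by
      rw [hP]
      apply convexHull_min
      · rintro _ ⟨s, hs, rfl⟩
        simp only [Set.mem_ofPred_eq, toR]
        by_cases h0 : s = (0, 0)
        · simp [h0]
        · exact hcon s ((hT s).2 ⟨h0, hSP s hs⟩)
      · intro x hx y hy α β hα hβ _
        simp only [Set.mem_ofPred_eq, Prod.fst_add, Prod.snd_add, Prod.smul_fst, Prod.smul_snd,
          smul_eq_mul] at *
        nlinarith [mul_nonneg hα hx, mul_nonneg hβ hy]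
    have hnh : P ∈ nhds (0 : ℝ × ℝ) := mem_interior_iff_mem_nhds.1 h0i
    have hcont : Continuous (fun t : ℝ => ((-(t * a), -(t * b)) : ℝ × ℝ)) := by fun_prop
    have : (fun t : ℝ => ((-(t * a), -(t * b)) : ℝ × ℝ)) ⁻¹' P ∈ nhds (0 : ℝ) := by
      apply hcont.continuousAt.preimage_mem_nhds
      simpa [← Prod.zero_eq_mk] using hnh
    obtain ⟨ε, hε, hball⟩ := Metric.mem_nhds_iff.1 this
    have hm : (ε / 2) ∈ Metric.ball (0 : ℝ) ε := by
      rw [Metric.mem_ball, Real.dist_eq, sub_zero, abs_of_pos (by linarith)]; linarith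
    have := hsub (hball hm)
    simp only [Set.mem_ofPred_eq] at this
    have hpos : 0 < a ^ 2 + b ^ 2 := by
      rcases hab with h | h <;> positivity
    nlinarith [mul_pos hε hpos]
  have hcomb : ∀ s ∈ T, ∀ t ∈ T, ∀ p : ℤ × ℤ, ∀ n a b : ℤ, 0 < n → 0 ≤ a → 0 ≤ b →
      n * p.1 = a * s.1 + b * t.1 → n * p.2 = a * s.2 + b * t.2 →
      toR p = ((a : ℝ) / n) • toR s + ((b : ℝ) / n) • toR t := by
    intro s hs t ht p n a b hn ha hb e1 e2
    have e1' : (n : ℝ) * p.1 = a * s.1 + b * t.1 := by exact_mod_cast e1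
    have e2' : (n : ℝ) * p.2 = a * s.2 + b * t.2 := by exact_mod_cast e2
    have hn' : (n : ℝ) ≠ 0 := by exact_mod_cast hn.ne'
    ext
    · simp only [toR, Prod.fst_add, Prod.smul_fst, smul_eq_mul]
      field_simp; linarith
    · simp only [toR, Prod.snd_add, Prod.smul_snd, smul_eq_mul]
      field_simp; linarith
  have hR : Rfl T := by
    refine ⟨?_, ?_, ?_, ?_⟩
    · simp [T]
    · intro s hs t ht p hp n a b hn ha hb e1 e2 hle
      rw [hT]
      refine ⟨hp, ?_⟩
      rw [hcomb s hs t ht p n a b hn ha hb e1 e2]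
      have hn' : (0 : ℝ) < n := by exact_mod_cast hn
      have ha' : (0 : ℝ) ≤ a := by exact_mod_cast ha
      have hb' : (0 : ℝ) ≤ b := by exact_mod_cast hb
      have hle' : (a : ℝ) + b ≤ n := by exact_mod_cast hle
      have hsum : (a : ℝ) / n + b / n ≤ 1 := by
        rw [← add_div, div_le_one hn']; exact hle'
      have := hconv.sum_mem (t := Finset.univ) (w := ![(a : ℝ) / n, b / n, 1 - (a / n + b / n)])
        (z := ![toR s, toR t, 0]) (by
          intro i _
          fin_cases i
          · simp; positivity
          · simp; positivity
          · simp; linarith) (by simp [Fin.sum_univ_three]) (by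
          intro i _
          fin_cases i
          · exact ((hT s).1 hs).2
          · exact ((hT t).1 ht).2
          · exact h0P)
      simpa [Fin.sum_univ_three] using this
    · intro s hs t ht p hp n a b hn ha hb e1 e2
      by_contra hlt
      push Not at hlt
      apply hp
      apply huniq
      have hab : 0 < a + b := by
        by_contra h0
        have ha0 : a = 0 := by omega
        have hb0 : b = 0 := by omega
        rw [ha0, hb0] at e1 e2
        simp only [zero_mul, add_zero, mul_eq_zero, hn.ne', false_or] at e1 e2
        exact hp (Prod.ext e1 e2)
      have hn' : (0 : ℝ) < n := by exact_mod_cast hn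
      have ha' : (0 : ℝ) ≤ a := by exact_mod_cast ha
      have hb' : (0 : ℝ) ≤ b := by exact_mod_cast hb
      have hab' : (0 : ℝ) < a + b := by exact_mod_cast hab
      have hlt' : (a : ℝ) + b < n := by exact_mod_cast hlt
      have hq : ((a : ℝ) / (a + b)) • toR s + ((b : ℝ) / (a + b)) • toR t ∈ P :=
        hconv ((hT s).1 hs).2 ((hT t).1 ht).2 (by positivity) (by positivity) (by field_simp)
      have hlt1 : ((a : ℝ) + b) / n < 1 := by rw [div_lt_one hn']; exact hlt'
      have := hconv.combo_interior_self_mem_interior h0i hq (a := 1 - (a + b) / n) (b := (a + b) / n)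
        (by linarith) (by positivity) (by ring)
      rw [hcomb s hs t ht p n a b hn ha hb e1 e2]
      convert this using 1
      rw [smul_zero, zero_add, smul_add, smul_smul, smul_smul]
      congr 2 <;> field_simp
    · intro v hv
      obtain ⟨s, hs, hlt⟩ := hlin v.2 (-v.1) (by
        by_contra hc
        push Not at hc
        apply hv
        have h1 : v.2 = 0 := by exact_mod_cast hc.1
        have h2 : v.1 = 0 := by have := hc.2; rw [neg_eq_zero] at this; exact_mod_cast this
        exact Prod.ext h2 h1)
      refine ⟨s, hs, ?_⟩
      have : (0 : ℝ) < v.1 * s.2 - v.2 * s.1 := by linarith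
      unfold dt
      exact_mod_cast this
  have hA : {p : ℤ × ℤ | toR p ∈ frontier P} = (T : Set (ℤ × ℤ)) := by
    ext p
    simp only [Set.mem_ofPred_eq, Finset.mem_coe, hT]
    rw [hcomp.isClosed.frontier_eq, Set.mem_sdiff]
    constructor
    · rintro ⟨a, b⟩
      refine ⟨?_, a⟩
      rintro rfl
      rw [hz] at b; exact b h0i
    · rintro ⟨a, b⟩
      exact ⟨b, fun hi => a (huniq p hi)⟩
  have hmemPd : ∀ u : ℤ × ℤ, toR u ∈ Pd ↔ ∀ t ∈ T, -1 ≤ ip u t := by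
    intro u
    rw [hPd]
    constructor
    · intro hu t ht
      have : (-1 : ℝ) ≤ u.1 * t.1 + u.2 * t.2 := hu _ ((hT t).1 ht).2
      unfold ip; exact_mod_cast this
    · intro hu
      have hsub : P ⊆ {x : ℝ × ℝ | -1 ≤ (u.1 : ℝ) * x.1 + u.2 * x.2} := by
        rw [hP]
        apply convexHull_min
        · rintro _ ⟨s, hs, rfl⟩
          simp only [Set.mem_ofPred_eq, toR]
          by_cases h0 : s = (0, 0)
          · simp [h0]
          · have := hu s ((hT s).2 ⟨h0, hSP s hs⟩)
            unfold ip at this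
            exact_mod_cast this
        · intro x hx y hy α β hα hβ hs
          simp only [Set.mem_ofPred_eq, Prod.fst_add, Prod.snd_add, Prod.smul_fst, Prod.smul_snd,
            smul_eq_mul] at *
          nlinarith [mul_le_mul_of_nonneg_left hx hα, mul_le_mul_of_nonneg_left hy hβ]
      intro x hx
      exact hsub hx
  have hclosed : IsClosed Pd := by
    have : Pd = ⋂ x ∈ P, {u : ℝ × ℝ | -1 ≤ u.1 * x.1 + u.2 * x.2} := by
      rw [hPd]; ext u; simp
    rw [this]
    refine isClosed_biInter (fun x _ => isClosed_le (by fun_prop) (by fun_prop))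
  have h0Pd : (0 : ℝ × ℝ) ∈ interior Pd := by
    obtain ⟨R, hRpos, hRb⟩ := hcomp.isBounded.exists_pos_norm_le
    rw [mem_interior_iff_mem_nhds, Metric.mem_nhds_iff]
    refine ⟨1 / (2 * R), by positivity, ?_⟩
    intro u hu
    rw [mem_ball_zero_iff] at hu
    rw [hPd]
    intro x hx
    have hx' := hRb x hx
    have a1 : |u.1| ≤ 1 / (2 * R) := (norm_fst_le u).trans hu.le
    have a2 : |u.2| ≤ 1 / (2 * R) := (norm_snd_le u).trans hu.le
    have b1 : |x.1| ≤ R := (norm_fst_le x).trans hx'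
    have b2 : |x.2| ≤ R := (norm_snd_le x).trans hx'
    have c1 : |u.1 * x.1| ≤ 1 / (2 * R) * R := by
      rw [abs_mul]; exact mul_le_mul a1 b1 (abs_nonneg _) (by positivity)
    have c2 : |u.2 * x.2| ≤ 1 / (2 * R) * R := by
      rw [abs_mul]; exact mul_le_mul a2 b2 (abs_nonneg _) (by positivity)
    have c3 : 1 / (2 * R) * R = 1 / 2 := by field_simp
    rw [c3] at c1 c2
    have d1 := (abs_le.1 c1).1
    have d2 := (abs_le.1 c2).1
    linarith
  have hB : {p : ℤ × ℤ | toR p ∈ frontier Pd} = dualSet T := by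
    ext u
    simp only [Set.mem_ofPred_eq, dualSet]
    rw [hclosed.frontier_eq, Set.mem_sdiff, hmemPd]
    constructor
    · rintro ⟨a, b⟩
      refine ⟨?_, a⟩
      rintro rfl
      rw [hz] at b; exact b h0Pd
    · rintro ⟨a, b⟩
      refine ⟨b, fun hi => ?_⟩
      obtain ⟨s, hs, hlt⟩ := hlin u.1 u.2 (by
        by_contra hc
        push Not at hc
        apply a
        exact Prod.ext (by exact_mod_cast hc.1) (by exact_mod_cast hc.2))
      have hle : (u.1 : ℝ) * s.1 + u.2 * s.2 ≤ -1 := by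
        have : u.1 * s.1 + u.2 * s.2 < 0 := by exact_mod_cast hlt
        have : u.1 * s.1 + u.2 * s.2 ≤ -1 := by omega
        exact_mod_cast this
      have hnh : Pd ∈ nhds (toR u) := mem_interior_iff_mem_nhds.1 hi
      have hcont : Continuous (fun t : ℝ => (((1 + t) * u.1, (1 + t) * u.2) : ℝ × ℝ)) := by fun_prop
      have : (fun t : ℝ => (((1 + t) * u.1, (1 + t) * u.2) : ℝ × ℝ)) ⁻¹' Pd ∈ nhds (0 : ℝ) := by
        apply hcont.continuousAt.preimage_mem_nhds
        simpa [toR] using hnh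
      obtain ⟨ε, hε, hball⟩ := Metric.mem_nhds_iff.1 this
      have hm : (ε / 2) ∈ Metric.ball (0 : ℝ) ε := by
        rw [Metric.mem_ball, Real.dist_eq, sub_zero, abs_of_pos (by linarith)]; linarith
      have := hball hm
      rw [Set.mem_preimage, hPd] at this
      have := this _ ((hT s).1 hs).2
      simp only [toR] at this
      nlinarith
  rw [hA, hB, Set.ncard_coe_finset]
  exact hR.main
end

section
/- Every triple (a, b, c) with a, b ∈ (1/2)ℤ, c ∈ ℤ, and a + b ∈ ℤ is realized as (A(P), (1/2)B(P), C(P)) for some lattice multi-polygon P; conversely any such triple arising from a lattice multi-polygon satisfies these conditions. -/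
open MeasureTheory

/-- The dot product of two vectors in `ℤ²`. -/
def dot (p q : ℤ × ℤ) : ℤ := p.1 * q.1 + p.2 * q.2

/-- A lattice multi-polygon: a closed piecewise-linear loop `v` with vertices in
`ℤ²` and nondegenerate sides, together with a sign `ε i ∈ {±1}` on each side
`v_i v_{i+1}`, subject to the condition (⋆): whenever `v_{i-1}, v_i, v_{i+1}` are
collinear, the signs of the two adjacent sides agree if `v_i` lies between
`v_{i-1}` and `v_{i+1}` (the two side directions have positive dot product), and
differ if the loop reverses at `v_i` (negative dot product), i.e. if `v_{i-1}`
lies on `v_i v_{i+1}` or `v_{i+1}` lies on `v_{i-1} v_i`. -/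
def IsMultiPolygon {d : ℕ} (v : ZMod d → ℤ × ℤ) (ε : ZMod d → ℤ) : Prop :=
  (∀ i, ε i = 1 ∨ ε i = -1) ∧
  (∀ i, v i ≠ v (i + 1)) ∧
  (∀ i, det (v i - v (i - 1)) (v (i + 1) - v i) = 0 →
    (0 < dot (v i - v (i - 1)) (v (i + 1) - v i) → ε (i - 1) = ε i) ∧
    (dot (v i - v (i - 1)) (v (i + 1) - v i) < 0 → ε (i - 1) ≠ ε i))

/-- The winding number `d_P(x)` of the loop `v_1 → … → v_d → v_1` around a point
`x` of the plane (valid off the loop). -/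
noncomputable def windingAt {d : ℕ} [NeZero d] (v : ZMod d → ℤ × ℤ) (x : ℂ) : ℝ :=
  (2 * Real.pi)⁻¹ * ∑ i : ZMod d, Complex.arg ((toC (v (i + 1)) - x) / (toC (v i) - x))

/-- `A(P)`: the integral over the plane of the winding number of the loop. -/
noncomputable def polyA {d : ℕ} [NeZero d] (v : ZMod d → ℤ × ℤ) : ℝ :=
  ∫ x : ℂ, windingAt v x

/-- `B(P) = Σ ε_i |v_i v_{i+1}|`, where `|v_i v_{i+1}|` is the number of lattice
points on the side `v_i v_{i+1}` minus one, i.e. the gcd of the coordinate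
differences. -/
def polyB {d : ℕ} [NeZero d] (v : ZMod d → ℤ × ℤ) (ε : ZMod d → ℤ) : ℤ :=
  ∑ i : ZMod d, ε i * (Int.gcd ((v (i + 1)).1 - (v i).1) ((v (i + 1)).2 - (v i).2) : ℤ)

/-- The normal vector `n_i` to the side `v_i v_{i+1}`: the 90° (counterclockwise)
rotation of `ε_i n_i` points along `v_{i+1} − v_i`, so
`n_i = −i · ε_i · (v_{i+1} − v_i)` as a complex number. -/
noncomputable def normalVec {d : ℕ} (v : ZMod d → ℤ × ℤ) (ε : ZMod d → ℤ) (i : ZMod d) : ℂ :=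
  -Complex.I * (ε i : ℂ) * (toC (v (i + 1)) - toC (v i))

/-- `C(P)`: the rotation number of the sequence of normal vectors `n_1, …, n_d`. -/
noncomputable def polyC {d : ℕ} [NeZero d] (v : ZMod d → ℤ × ℤ) (ε : ZMod d → ℤ) : ℝ :=
  (2 * Real.pi)⁻¹ *
    ∑ i : ZMod d, Complex.arg (normalVec v ε (i + 1) / normalVec v ε i)


/-! ### Area -/

/-- Real cross product on the complex plane. -/
def crs (p q : ℂ) : ℝ := p.re * q.im - p.im * q.re

theorem vol_std (D : ℝ) (hD : 0 < D) :
    volume {z : ℂ | 0 < z.re ∧ 0 < z.im ∧ z.re + z.im < D} = ENNReal.ofReal (D ^ 2 / 2) := by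
  have hset : {z : ℂ | 0 < z.re ∧ 0 < z.im ∧ z.re + z.im < D} =
      Complex.measurableEquivRealProd ⁻¹'
        (regionBetween (fun _ : ℝ => (0 : ℝ)) (fun x => D - x) (Set.Ioo 0 D)) := by
    ext z
    simp only [Set.mem_ofPred_eq, Set.mem_preimage, regionBetween,
      Complex.measurableEquivRealProd_apply, Set.mem_Ioo]
    constructor
    · rintro ⟨h1, h2, h3⟩
      exact ⟨⟨h1, by linarith⟩, h2, by linarith⟩
    · rintro ⟨⟨h1, h2⟩, h3, h4⟩
      exact ⟨h1, h3, by linarith⟩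
  have hc : Continuous (fun x : ℝ => D - x) := by fun_prop
  rw [hset, Complex.volume_preserving_equiv_real_prod.measure_preimage_equiv, Measure.volume_eq_prod,
    volume_regionBetween_eq_integral]
  · congr 1
    rw [← integral_Ioc_eq_integral_Ioo, ← intervalIntegral.integral_of_le hD.le]
    simp only [Pi.sub_apply, sub_zero]
    rw [intervalIntegral.integral_sub (by simp) (by simp)]
    simp
    ring
  · exact (continuous_const.integrableOn_Icc).mono_set Set.Ioo_subset_Icc_self
  · exact (hc.integrableOn_Icc).mono_set Set.Ioo_subset_Icc_self
  · exact measurableSet_Ioo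
  · intro x hx
    have := hx.2
    linarith

def posSet (p q : ℂ) : Set ℂ :=
  {x | 0 < crs (-x) (p - x) ∧ 0 < crs (p - x) (q - x) ∧ 0 < crs (q - x) (-x)}

theorem posSet_meas (p q : ℂ) : MeasurableSet (posSet p q) := by
  have e : posSet p q = {x | 0 < crs (-x) (p - x)} ∩
      ({x | 0 < crs (p - x) (q - x)} ∩ {x | 0 < crs (q - x) (-x)}) := by
    ext x
    simp [posSet]
  rw [e]
  unfold crs
  refine (isOpen_lt ?_ ?_).measurableSet.inter
    ((isOpen_lt ?_ ?_).measurableSet.inter (isOpen_lt ?_ ?_).measurableSet) <;> fun_prop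

theorem vol_pos (p q : ℂ) :
    volume (posSet p q) = ENNReal.ofReal (max (crs p q) 0 / 2) := by
  rcases le_or_gt (crs p q) 0 with h | h
  · have : posSet p q = ∅ := by
      ext x
      simp only [posSet, Set.mem_ofPred_eq, Set.mem_empty_iff_false, iff_false]
      rintro ⟨h1, h2, h3⟩
      simp only [crs, Complex.neg_re, Complex.neg_im, Complex.sub_re, Complex.sub_im] at *
      nlinarith
    rw [this, max_eq_right h]; simp
  · let g : ℂ →ₗ[ℝ] ℂ := Matrix.toLin Complex.basisOneI Complex.basisOneI
      !![q.im, -q.re; -p.im, p.re]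
    have hg : ∀ x, g x = ⟨crs x q, crs p x⟩ := by
      intro x
      simp only [g, Matrix.toLin_apply, crs]
      apply Complex.ext <;>
      simp [Complex.coe_basisOneI_repr, Complex.coe_basisOneI, Matrix.mulVec, dotProduct, Fin.sum_univ_two] <;> ring
    have hdet : LinearMap.det g = crs p q := by
      simp only [g, LinearMap.det_toLin, Matrix.det_fin_two_of, crs]; ring
    have hset : posSet p q = g ⁻¹' {z : ℂ | 0 < z.re ∧ 0 < z.im ∧ z.re + z.im < crs p q} := by
      ext x
      simp only [posSet, Set.mem_preimage, hg, Set.mem_ofPred_eq]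
      simp only [crs, Complex.neg_re, Complex.neg_im, Complex.sub_re, Complex.sub_im] at *
      constructor
      · rintro ⟨h1, h2, h3⟩
        refine ⟨by linarith, by linarith, by linarith⟩
      · rintro ⟨h1, h2, h3⟩
        refine ⟨by linarith, by linarith, by linarith⟩
    rw [hset, Measure.addHaar_preimage_linearMap _ (by rw [hdet]; exact h.ne'), vol_std _ h, hdet,
      ← ENNReal.ofReal_mul (abs_nonneg _), max_eq_left h.le, abs_of_pos (inv_pos.mpr h)]
    congr 1
    field_simp

theorem ae_arg_ne_pi (p q : ℂ) : ∀ᵐ x : ℂ, Complex.arg ((q - x) / (p - x)) ≠ Real.pi := by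
  by_cases hpq : p = q
  · subst hpq
    refine Filter.Eventually.of_forall fun x h => ?_
    rw [Complex.arg_eq_pi_iff] at h
    by_cases hx : p - x = 0
    · simp [hx] at h
    · rw [div_self hx] at h
      have := h.1
      norm_num at this
  · let L : ℂ →ₗ[ℝ] ℝ := (q - p).im • Complex.reLm - (q - p).re • Complex.imLm
    have hL : ∀ x, L x = (q - p).im * x.re - (q - p).re * x.im := fun x => by simp [L]
    have hne : LinearMap.ker L ≠ ⊤ := by
      intro htop
      have h1 : (⟨(q - p).im, -(q - p).re⟩ : ℂ) ∈ LinearMap.ker L := by rw [htop]; trivial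
      rw [LinearMap.mem_ker, hL] at h1
      apply hpq
      simp only at h1
      have h2 : (q - p).im = 0 := by
        apply pow_eq_zero_iff (two_ne_zero) |>.mp
        nlinarith [sq_nonneg (q - p).im, sq_nonneg (q - p).re]
      have h3 : (q - p).re = 0 := by
        apply pow_eq_zero_iff (two_ne_zero) |>.mp
        nlinarith [sq_nonneg (q - p).im, sq_nonneg (q - p).re]
      exact (sub_eq_zero.mp (Complex.ext h3 h2)).symm
    have h0 := Measure.addHaar_submodule (volume : Measure ℂ) _ hne
    rw [← measure_preimage_add_right volume (-p)] at h0
    rw [ae_iff]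
    refine measure_mono_null ?_ h0
    intro x hx
    simp only [not_not, Set.mem_ofPred_eq] at hx
    rw [Complex.arg_eq_pi_iff] at hx
    obtain ⟨hx1, hx2⟩ := hx
    have hpx : p - x ≠ 0 := by
      intro h; simp [h] at hx1
    set r := (q - x) / (p - x) with hr
    have he : q - x = r * (p - x) := by rw [hr]; field_simp
    have e1 := congrArg Complex.re he
    have e2 := congrArg Complex.im he
    simp only [Complex.mul_re, Complex.mul_im, hx2, Complex.sub_re, Complex.sub_im] at e1 e2
    simp only [Set.mem_preimage, SetLike.mem_coe, LinearMap.mem_ker, hL, Complex.add_re,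
      Complex.neg_re, Complex.neg_im, Complex.add_im, Complex.sub_re, Complex.sub_im]
    have a1 : q.re = x.re + r.re * (p.re - x.re) := by linarith
    have a2 : q.im = x.im + r.re * (p.im - x.im) := by linarith
    rw [a1, a2]; ring

noncomputable def tri (p q x : ℂ) : ℝ :=
  (2 * Real.pi)⁻¹ * (Complex.arg ((q - x) / (p - x)) + Complex.arg ((p - x) / (-x))
    - Complex.arg ((q - x) / (-x)))

theorem im_div_crs (a b : ℂ) : (b / a).im = crs a b / Complex.normSq a := by
  rw [Complex.div_im, crs]; ring

theorem arg_pos_crs {a b : ℂ} (ha : a ≠ 0) : 0 < crs a b ↔ 0 < (b / a).im := by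
  rw [im_div_crs]
  have := Complex.normSq_pos.mpr ha
  constructor
  · intro h; positivity
  · intro h
    by_contra hc
    have := div_nonpos_of_nonpos_of_nonneg (not_lt.mp hc) this.le
    linarith

theorem arg_neg_crs {a b : ℂ} (ha : a ≠ 0) : 0 < crs b a ↔ (b / a).im < 0 := by
  have : crs b a = - crs a b := by simp only [crs]; ring
  rw [this, im_div_crs]
  have := Complex.normSq_pos.mpr ha
  rw [div_neg_iff]
  constructor
  · intro h; right; constructor <;> linarith
  · rintro (h | h)
    · linarith [h.2]
    · linarith [h.1]

theorem arg_pos_of_im {z : ℂ} : 0 < z.arg → 0 ≤ z.im := fun h => Complex.arg_nonneg_iff.mp h.le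

theorem tri_core {a b c : ℂ} (ha : a ≠ 0) (hb : b ≠ 0) (hc : c ≠ 0)
    (h1 : Complex.arg (c / b) ≠ Real.pi) (h2 : Complex.arg (b / a) ≠ Real.pi)
    (h3 : Complex.arg (c / a) ≠ Real.pi) :
    (2 * Real.pi)⁻¹ * (Complex.arg (c / b) + Complex.arg (b / a) - Complex.arg (c / a)) =
      (open Classical in if 0 < crs a b ∧ 0 < crs b c ∧ 0 < crs c a then (1 : ℝ) else 0) -
      (open Classical in if 0 < crs a c ∧ 0 < crs c b ∧ 0 < crs b a then (1 : ℝ) else 0) := by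
  have hpi := Real.pi_pos
  simp only [@arg_pos_crs a b ha, @arg_pos_crs b c hb, @arg_neg_crs a c ha, @arg_pos_crs a c ha,
    @arg_neg_crs b c hb, @arg_neg_crs a b ha]
  have hang : ((Complex.arg (c / b) + Complex.arg (b / a) : ℝ) : Real.Angle)
      = (Complex.arg (c / a) : ℝ) := by
    have e : c / a = (c / b) * (b / a) := by field_simp
    rw [e, Complex.arg_mul_coe_angle (div_ne_zero hc hb) (div_ne_zero hb ha)]
    simp
  obtain ⟨k, hk⟩ := Real.Angle.angle_eq_iff_two_pi_dvd_sub.mp hang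
  have b1 := lt_of_le_of_ne (Complex.arg_le_pi _) h1
  have b2 := lt_of_le_of_ne (Complex.arg_le_pi _) h2
  have b3 := lt_of_le_of_ne (Complex.arg_le_pi _) h3
  have c1 := Complex.neg_pi_lt_arg (c / b)
  have c2 := Complex.neg_pi_lt_arg (b / a)
  have c3 := Complex.neg_pi_lt_arg (c / a)
  have n1 := @Complex.arg_neg_iff (c / b)
  have n2 := @Complex.arg_neg_iff (b / a)
  have n3 := @Complex.arg_neg_iff (c / a)
  have p1 := @Complex.arg_nonneg_iff (c / b)
  have p2 := @Complex.arg_nonneg_iff (b / a)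
  have p3 := @Complex.arg_nonneg_iff (c / a)
  have z1 := @Complex.arg_eq_zero_iff (c / b)
  have z2 := @Complex.arg_eq_zero_iff (b / a)
  have z3 := @Complex.arg_eq_zero_iff (c / a)
  have pos : ∀ z : ℂ, z.arg < Real.pi → (0 < z.im ↔ 0 < z.arg) := by
    intro z hz
    constructor
    · intro h
      rcases (Complex.arg_nonneg_iff.mpr h.le).lt_or_eq with h' | h'
      · exact h'
      · rw [eq_comm, Complex.arg_eq_zero_iff] at h'; linarith [h'.2]
    · intro h
      rcases (Complex.arg_nonneg_iff.mp h.le).lt_or_eq with h' | h'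
      · exact h'
      · exfalso
        rcases le_or_gt 0 z.re with hr | hr
        · have := Complex.arg_eq_zero_iff.mpr ⟨hr, h'.symm⟩; linarith
        · have := Complex.arg_eq_pi_iff.mpr ⟨hr, h'.symm⟩; linarith
  simp only [pos _ b1, pos _ b2, pos _ b3, ← n1, ← n2, ← n3]
  clear n1 n2 n3 p1 p2 p3 z1 z2 z3 pos hang h1 h2 h3
  rw [hk]
  generalize Complex.arg (c / b) = β at *
  generalize Complex.arg (b / a) = α at *
  generalize Complex.arg (c / a) = γ at *
  have hval : (2 * Real.pi)⁻¹ * (2 * Real.pi * (k : ℝ)) = k := by field_simp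
  rw [hval]
  have hkl : (-2 : ℤ) < k := by
    have : (-2 : ℝ) < k := by nlinarith
    exact_mod_cast this
  have hku : k < 2 := by
    have : (k : ℝ) < 2 := by nlinarith
    exact_mod_cast this
  have hk3 : k = -1 ∨ k = 0 ∨ k = 1 := by omega
  rcases hk3 with rfl | rfl | rfl <;> push_cast at hk ⊢
  · rw [if_neg (by rintro ⟨_, _, _⟩; linarith), if_pos (by refine ⟨?_, ?_, ?_⟩ <;> linarith)]
    norm_num
  · rw [if_neg (by rintro ⟨_, _, _⟩; linarith), if_neg (by rintro ⟨_, _, _⟩; linarith)]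
    norm_num
  · rw [if_pos (by refine ⟨?_, ?_, ?_⟩ <;> linarith), if_neg (by rintro ⟨_, _, _⟩; linarith)]
    norm_num

theorem tri_ae (p q : ℂ) : tri p q =ᵐ[volume]
    fun x => (posSet p q).indicator (fun _ => (1 : ℝ)) x - (posSet q p).indicator (fun _ => (1 : ℝ)) x := by
  have hne : ∀ y : ℂ, ∀ᵐ x : ℂ, x ≠ y := fun y => by
    rw [ae_iff]; simp
  have := ae_arg_ne_pi 0 p
  filter_upwards [ae_arg_ne_pi p q, ae_arg_ne_pi 0 p, ae_arg_ne_pi 0 q, hne 0, hne p, hne q]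
    with x h1 h2 h3 h4 h5 h6
  rw [zero_sub] at h2 h3
  have := tri_core (neg_ne_zero.mpr h4) (sub_ne_zero.mpr h5.symm) (sub_ne_zero.mpr h6.symm) h1 h2 h3
  rw [tri, this]
  simp only [Set.indicator_apply, posSet, Set.mem_ofPred_eq]

theorem tri_integrable (p q : ℂ) : Integrable (tri p q) ∧ ∫ x, tri p q x = crs p q / 2 := by
  have hi : ∀ p q, Integrable ((posSet p q).indicator (fun _ => (1 : ℝ))) := fun p q => by
    rw [integrable_indicator_iff (posSet_meas p q)]
    apply integrableOn_const
    · rw [vol_pos]; exact ENNReal.ofReal_ne_top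
    · simp
  refine ⟨((hi p q).sub (hi q p)).congr (tri_ae p q).symm, ?_⟩
  rw [integral_congr_ae (tri_ae p q), integral_sub (hi p q) (hi q p),
    integral_indicator (posSet_meas p q), integral_indicator (posSet_meas q p)]
  simp only [integral_const, smul_eq_mul, mul_one, measureReal_def, Measure.restrict_apply_univ,
    vol_pos]
  rw [ENNReal.toReal_ofReal (by positivity), ENNReal.toReal_ofReal (by positivity)]
  have : crs q p = - crs p q := by simp only [crs]; ring
  rw [this]
  rcases le_total 0 (crs p q) with h | h
  · rw [max_eq_left h, max_eq_right (by linarith)]; ring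
  · rw [max_eq_right h, max_eq_left (by linarith)]; ring

theorem crs_toC (p q : ℤ × ℤ) : crs (toC p) (toC q) = (det p q : ℝ) := by
  simp [crs, toC, det]

theorem sum_shift {d : ℕ} [NeZero d] {M : Type*} [AddCommMonoid M] (f : ZMod d → M) :
    ∑ i, f (i + 1) = ∑ i, f i :=
  Fintype.sum_equiv (Equiv.addRight 1) _ _ (fun _ => rfl)

theorem polyA_eq {d : ℕ} [NeZero d] (v : ZMod d → ℤ × ℤ) :
    polyA v = ((∑ i, det (v i) (v (i + 1)) : ℤ) : ℝ) / 2 := by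
  have h : ∀ x, windingAt v x = ∑ i, tri (toC (v i)) (toC (v (i + 1))) x := by
    intro x
    simp only [windingAt, tri]
    rw [← Finset.mul_sum, Finset.sum_sub_distrib, Finset.sum_add_distrib,
      sum_shift (fun i => Complex.arg ((toC (v i) - x) / (-x)))]
    ring
  rw [polyA]
  simp_rw [h]
  rw [integral_finsetSum _ (fun i _ => (tri_integrable _ _).1)]
  simp_rw [(tri_integrable _ _).2, crs_toC]
  rw [← Finset.sum_div]
  push_cast
  rfl

/-! ### Parity -/

theorem gcd_parity (x y : ℤ) : ((Int.gcd x y : ℤ) : ZMod 2) = x + y + x * y := by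
  have h2 : ∀ n : ℤ, (n : ZMod 2) = if 2 ∣ n then 0 else 1 := by
    intro n
    split_ifs with h
    · exact (ZMod.intCast_zmod_eq_zero_iff_dvd n 2).mpr h
    · obtain ⟨k, rfl⟩ : ∃ k, n = 2 * k + 1 := ⟨n / 2, by omega⟩
      push_cast
      rw [show (2 : ZMod 2) = 0 from rfl]; simp
  rw [h2 x, h2 y, h2 (Int.gcd x y)]
  simp only [Int.dvd_coe_gcd_iff]
  by_cases hx : (2 : ℤ) ∣ x <;> by_cases hy : (2 : ℤ) ∣ y <;> simp [hx, hy] <;> decide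

theorem parity {d : ℕ} [NeZero d] (v : ZMod d → ℤ × ℤ) (ε : ZMod d → ℤ)
    (hε : ∀ i, ε i = 1 ∨ ε i = -1) :
    ((∑ i, det (v i) (v (i + 1)) + polyB v ε : ℤ) : ZMod 2) = 0 := by
  have key : ∀ i, (((det (v i) (v (i + 1)) : ℤ) : ZMod 2)
      + ((ε i * (Int.gcd ((v (i + 1)).1 - (v i).1) ((v (i + 1)).2 - (v i).2) : ℤ) : ℤ) : ZMod 2))
      = (fun j => (((v j).1 + (v j).2 + (v j).1 * (v j).2 : ℤ) : ZMod 2)) (i + 1) -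
        (fun j => (((v j).1 + (v j).2 + (v j).1 * (v j).2 : ℤ) : ZMod 2)) i := by
    intro i
    have he : ((ε i : ℤ) : ZMod 2) = 1 := by
      rcases hε i with h | h <;> rw [h] <;> decide
    rw [Int.cast_mul, he, gcd_parity]
    simp only [det]
    push_cast
    generalize (((v i).1 : ℤ) : ZMod 2) = a
    generalize (((v i).2 : ℤ) : ZMod 2) = b
    generalize (((v (i + 1)).1 : ℤ) : ZMod 2) = c
    generalize (((v (i + 1)).2 : ℤ) : ZMod 2) = e
    revert a b c e
    decide
  rw [polyB, Int.cast_add, Int.cast_sum, Int.cast_sum, ← Finset.sum_add_distrib,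
    Finset.sum_congr rfl (fun i _ => key i), Finset.sum_sub_distrib,
    sum_shift (fun j => (((v j).1 + (v j).2 + (v j).1 * (v j).2 : ℤ) : ZMod 2)), sub_self]

/-! ### Realization -/

theorem toC_ne_zero {u : ℤ × ℤ} (h : u ≠ 0) : toC u ≠ 0 := by
  intro h0
  apply h
  have h1 := congrArg Complex.re h0
  have h2 := congrArg Complex.im h0
  simp only [toC, Complex.zero_re, Complex.zero_im, Int.cast_eq_zero] at h1 h2
  exact Prod.ext h1 h2

/-- Closed loops based at the origin with prescribed first and next direction. -/
def Good (A B C : ℤ) : Prop :=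
  ∃ (d : ℕ) (p u : ℕ → ℤ × ℤ) (ε : ℕ → ℤ), 0 < d ∧ p 0 = 0 ∧ p d = 0 ∧ u 0 = (1, 0) ∧ u d = (1, 0) ∧
    (∀ i < d, (ε i = 1 ∨ ε i = -1) ∧ p (i + 1) - p i = ε i • u i ∧ u i ≠ 0 ∧
      (det (u i) (u (i + 1)) = 0 → 0 < dot (u i) (u (i + 1)))) ∧
    ∑ i ∈ Finset.range d, det (p i) (p (i + 1)) = A ∧
    ∑ i ∈ Finset.range d, ε i * (Int.gcd (u i).1 (u i).2 : ℤ) = B ∧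
    ∑ i ∈ Finset.range d, Complex.arg (toC (u (i + 1)) / toC (u i)) = 2 * Real.pi * C

theorem Good.add {A B C A' B' C' : ℤ} (h : Good A B C) (h' : Good A' B' C') :
    Good (A + A') (B + B') (C + C') := by
  obtain ⟨d, p, u, ε, hd, p0, pd, u0, ud, hi, hA, hB, hC⟩ := h
  obtain ⟨d', p', u', ε', hd', p0', pd', u0', ud', hi', hA', hB', hC'⟩ := h'
  let P : ℕ → ℤ × ℤ := fun i => if i < d then p i else p' (i - d)
  let U : ℕ → ℤ × ℤ := fun i => if i < d then u i else u' (i - d)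
  let E : ℕ → ℤ := fun i => if i < d then ε i else ε' (i - d)
  have P1 : ∀ i ≤ d, P i = p i := by
    intro i hi
    rcases hi.lt_or_eq with h | rfl
    · simp [P, h]
    · simp [P, p0', pd]
  have U1 : ∀ i ≤ d, U i = u i := by
    intro i hi
    rcases hi.lt_or_eq with h | rfl
    · simp [U, h]
    · simp [U, u0', ud]
  have E1 : ∀ i < d, E i = ε i := fun i hi => by simp [E, hi]
  have P2 : ∀ i, P (d + i) = p' i := fun i => by simp [P]
  have U2 : ∀ i, U (d + i) = u' i := fun i => by simp [U]
  have E2 : ∀ i, E (d + i) = ε' i := fun i => by simp [E]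
  refine ⟨d + d', P, U, E, by omega, ?_, ?_, ?_, ?_, ?_, ?_, ?_, ?_⟩
  · rw [P1 _ (by omega), p0]
  · rw [P2, pd']
  · rw [U1 _ (by omega), u0]
  · rw [U2, ud']
  · intro i hid
    rcases lt_or_ge i d with h | h
    · rw [P1 i h.le, P1 (i + 1) h, U1 i h.le, U1 (i + 1) h, E1 i h]
      exact hi i h
    · obtain ⟨j, rfl⟩ := Nat.exists_eq_add_of_le h
      rw [add_assoc, P2, P2, U2, U2, E2]
      exact hi' j (by omega)
  · rw [Finset.sum_range_add, ← hA, ← hA']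
    congr 1
    · refine Finset.sum_congr rfl fun i hi => ?_
      have := Finset.mem_range.mp hi
      rw [P1 i this.le, P1 (i + 1) this]
    · refine Finset.sum_congr rfl fun i hi => ?_
      rw [add_assoc, P2, P2]
  · rw [Finset.sum_range_add, ← hB, ← hB']
    congr 1
    · refine Finset.sum_congr rfl fun i hi => ?_
      have := Finset.mem_range.mp hi
      rw [U1 i this.le, E1 i this]
    · refine Finset.sum_congr rfl fun i hi => ?_
      rw [U2, E2]
  · rw [Finset.sum_range_add]
    push_cast
    rw [mul_add, ← hC, ← hC']
    congr 1
    · refine Finset.sum_congr rfl fun i hi => ?_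
      have := Finset.mem_range.mp hi
      rw [U1 i this.le, U1 (i + 1) this]
    · refine Finset.sum_congr rfl fun i hi => ?_
      rw [add_assoc, U2, U2]

theorem arg_diag : Complex.arg ⟨1, 1⟩ = Real.pi / 4 := by
  have h := @Complex.arg_mul_cos_add_sin_mul_I (Real.sqrt 2) (by positivity) (Real.pi / 4)
    ⟨by linarith [Real.pi_pos], by linarith [Real.pi_pos]⟩
  rw [← h]
  congr 1
  rw [← Complex.ofReal_cos, ← Complex.ofReal_sin, Real.cos_pi_div_four, Real.sin_pi_div_four]
  have : Real.sqrt 2 * (Real.sqrt 2 / 2) = 1 := by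
    have := Real.mul_self_sqrt (show (0 : ℝ) ≤ 2 by norm_num)
    linarith
  apply Complex.ext <;> simp [this]

theorem arg_diag' : Complex.arg ⟨1, -1⟩ = -(Real.pi / 4) := by
  have : (⟨1, -1⟩ : ℂ) = (starRingEnd ℂ) ⟨1, 1⟩ := by apply Complex.ext <;> simp
  rw [this, Complex.arg_conj, arg_diag, if_neg]
  linarith [Real.pi_pos]

/-- `turn` of a pair: `w / u = r * z` with `r > 0`. -/
theorem turn_eq (u w : ℤ × ℤ) (r : ℝ) (z : ℂ) (hr : 0 < r) (hu : u ≠ 0)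
    (h : toC w = (r : ℂ) * z * toC u) : Complex.arg (toC w / toC u) = Complex.arg z := by
  rw [h, mul_div_cancel_right₀ _ (toC_ne_zero hu), Complex.arg_real_mul _ hr]

theorem turn_I (u w : ℤ × ℤ) (hu : u ≠ 0) (h : w = (-u.2, u.1)) :
    Complex.arg (toC w / toC u) = Real.pi / 2 := by
  rw [turn_eq u w 1 Complex.I one_pos hu, Complex.arg_I]
  subst h
  apply Complex.ext <;> simp [toC]

theorem turn_negI (u w : ℤ × ℤ) (hu : u ≠ 0) (h : w = (u.2, -u.1)) :
    Complex.arg (toC w / toC u) = -(Real.pi / 2) := by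
  rw [turn_eq u w 1 (-Complex.I) one_pos hu, Complex.arg_neg_I]
  subst h
  apply Complex.ext <;> simp [toC]

theorem turn_d1 : Complex.arg (toC (1, 1) / toC (1, 0)) = Real.pi / 4 := by
  rw [turn_eq _ _ 1 ⟨1, 1⟩ one_pos (by decide), arg_diag]
  apply Complex.ext <;> simp [toC]

theorem turn_d2 : Complex.arg (toC (0, 1) / toC (1, 1)) = Real.pi / 4 := by
  rw [turn_eq _ _ (1 / 2) ⟨1, 1⟩ (by norm_num) (by decide), arg_diag]
  apply Complex.ext <;> simp [toC] <;> norm_num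

theorem turn_d3 : Complex.arg (toC (1, 1) / toC (0, 1)) = -(Real.pi / 4) := by
  rw [turn_eq _ _ 1 ⟨1, -1⟩ one_pos (by decide), arg_diag']
  apply Complex.ext <;> simp [toC]

theorem turn_d4 : Complex.arg (toC (1, 0) / toC (1, 1)) = -(Real.pi / 4) := by
  rw [turn_eq _ _ (1 / 2) ⟨1, -1⟩ (by norm_num) (by decide), arg_diag']
  apply Complex.ext <;> simp [toC] <;> norm_num

theorem good_zero : Good 0 0 0 := by
  refine ⟨2, fun i => [(0, 0), (1, 0)].getD i 0, fun _ => (1, 0), fun i => [1, -1].getD i 0,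
    by decide, rfl, rfl, rfl, rfl, by decide, by decide, by decide, ?_⟩
  have : toC (1, 0) ≠ 0 := toC_ne_zero (by decide)
  simp [div_self this]

theorem good_a : Good 2 0 0 := by
  refine ⟨4, fun i => [(0, 0), (1, 0), (1, 1), (0, 1)].getD i 0,
    fun i => [(1, 0), (0, 1), (1, 0), (0, 1)].getD i (1, 0), fun i => [1, 1, -1, -1].getD i 0,
    by decide, rfl, rfl, rfl, rfl, by decide, by decide, by decide, ?_⟩
  simp [Finset.sum_range_succ, turn_I (1, 0) (0, 1) (by decide) (by decide),
    turn_negI (0, 1) (1, 0) (by decide) (by decide)]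

theorem good_a' : Good (-2) 0 0 := by
  refine ⟨4, fun i => [(0, 0), (1, 0), (1, -1), (0, -1)].getD i 0,
    fun i => [(1, 0), (0, 1), (1, 0), (0, 1)].getD i (1, 0), fun i => [1, -1, -1, 1].getD i 0,
    by decide, rfl, rfl, rfl, rfl, by decide, by decide, by decide, ?_⟩
  simp [Finset.sum_range_succ, turn_I (1, 0) (0, 1) (by decide) (by decide),
    turn_negI (0, 1) (1, 0) (by decide) (by decide)]

theorem good_c : Good (-2) 0 1 := by
  refine ⟨4, fun i => [(0, 0), (1, 0), (1, -1), (0, -1)].getD i 0,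
    fun i => [(1, 0), (0, 1), (-1, 0), (0, -1)].getD i (1, 0), fun i => [1, -1, 1, -1].getD i 0,
    by decide, rfl, rfl, rfl, rfl, by decide, by decide, by decide, ?_⟩
  simp [Finset.sum_range_succ, turn_I (1, 0) (0, 1) (by decide) (by decide),
    turn_I (0, 1) (-1, 0) (by decide) (by decide), turn_I (-1, 0) (0, -1) (by decide) (by decide),
    turn_I (0, -1) (1, 0) (by decide) (by decide)]
  ring

theorem good_c' : Good 2 0 (-1) := by
  refine ⟨4, fun i => [(0, 0), (1, 0), (1, 1), (0, 1)].getD i 0,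
    fun i => [(1, 0), (0, -1), (-1, 0), (0, 1)].getD i (1, 0), fun i => [1, -1, 1, -1].getD i 0,
    by decide, rfl, rfl, rfl, rfl, by decide, by decide, by decide, ?_⟩
  simp [Finset.sum_range_succ, turn_negI (1, 0) (0, -1) (by decide) (by decide),
    turn_negI (0, -1) (-1, 0) (by decide) (by decide),
    turn_negI (-1, 0) (0, 1) (by decide) (by decide),
    turn_negI (0, 1) (1, 0) (by decide) (by decide)]
  ring

theorem good_b : Good 1 1 0 := by
  refine ⟨3, fun i => [(0, 0), (1, 0), (1, 1)].getD i 0,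
    fun i => [(1, 0), (0, 1), (1, 1)].getD i (1, 0), fun i => [1, 1, -1].getD i 0,
    by decide, rfl, rfl, rfl, rfl, by decide, by decide, by decide, ?_⟩
  simp [Finset.sum_range_succ, turn_I (1, 0) (0, 1) (by decide) (by decide), turn_d3, turn_d4]
  ring

theorem good_b' : Good (-1) (-1) 0 := by
  refine ⟨3, fun i => [(0, 0), (-1, 0), (0, 1)].getD i 0,
    fun i => [(1, 0), (1, 1), (0, 1)].getD i (1, 0), fun i => [-1, 1, -1].getD i 0,
    by decide, rfl, rfl, rfl, rfl, by decide, by decide, by decide, ?_⟩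
  simp [Finset.sum_range_succ, turn_negI (0, 1) (1, 0) (by decide) (by decide), turn_d1, turn_d2]
  ring

theorem Good.nmul {A B C : ℤ} (h : Good A B C) (n : ℕ) : Good (n * A) (n * B) (n * C) := by
  induction n with
  | zero => simpa using good_zero
  | succ n ih =>
    have := ih.add h
    push_cast
    simpa only [add_mul, one_mul] using this

theorem Good.zmul {A B C : ℤ} (h : Good A B C) (h' : Good (-A) (-B) (-C)) (n : ℤ) :
    Good (n * A) (n * B) (n * C) := by
  obtain ⟨k, rfl | rfl⟩ := n.eq_nat_or_neg
  · exact h.nmul k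
  · simpa only [mul_neg, neg_mul] using h'.nmul k

theorem good_all (A B C : ℤ) (h : 2 ∣ A + B) : Good A B C := by
  obtain ⟨k, hk⟩ := h
  have h1 := good_a.zmul good_a' (k - B + C)
  have h2 := good_b.zmul good_b' B
  have h3 := good_c.zmul good_c' C
  have := (h1.add h2).add h3
  convert this using 1 <;> linarith

theorem sum_zmod {d : ℕ} [NeZero d] {M : Type*} [AddCommMonoid M] (f : ℕ → M) :
    ∑ i : ZMod d, f i.val = ∑ i ∈ Finset.range d, f i := by
  obtain ⟨n, rfl⟩ := Nat.exists_eq_succ_of_ne_zero (NeZero.ne d)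
  exact Fin.sum_univ_eq_sum_range f (n + 1)

theorem succ_zmod {d : ℕ} [NeZero d] {M : Type*} (f : ℕ → M) (hf : f d = f 0) (i : ZMod d) :
    f (i + 1).val = f (i.val + 1) := by
  have hi := i.val_lt
  have e : (i + 1).val = (i.val + 1) % d := by
    rw [ZMod.val_add]
    rw [ZMod.val_one_eq_one_mod, Nat.add_mod_mod]
  rw [e]
  rcases Nat.lt_or_ge (i.val + 1) d with h | h
  · rw [Nat.mod_eq_of_lt h]
  · have : i.val + 1 = d := by omega
    rw [this, Nat.mod_self, hf]

theorem good_real {A B C : ℤ} (h : Good A B C) :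
    ∃ (d : ℕ) (_ : NeZero d) (v : ZMod d → ℤ × ℤ) (ε : ZMod d → ℤ),
        IsMultiPolygon v ε ∧ polyA v = A / 2 ∧ polyB v ε = B ∧ polyC v ε = C := by
  obtain ⟨d, p, u, ε, hd, p0, pd, u0, ud, hi, hA, hB, hC⟩ := h
  haveI : NeZero d := ⟨hd.ne'⟩
  have hp : ∀ i : ZMod d, p (i + 1).val = p (i.val + 1) := succ_zmod p (by rw [p0, pd])
  have hu : ∀ i : ZMod d, u (i + 1).val = u (i.val + 1) := succ_zmod u (by rw [u0, ud])
  have hstep : ∀ i : ZMod d, p (i + 1).val - p i.val = ε i.val • u i.val := fun i => by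
    rw [hp]; exact (hi _ i.val_lt).2.1
  have hε : ∀ i : ZMod d, ε i.val = 1 ∨ ε i.val = -1 := fun i => (hi _ i.val_lt).1
  have hne : ∀ i : ZMod d, u i.val ≠ 0 := fun i => (hi _ i.val_lt).2.2.1
  have hok : ∀ i : ZMod d, det (u i.val) (u (i + 1).val) = 0 → 0 < dot (u i.val) (u (i + 1).val) :=
    fun i => by rw [hu]; exact (hi _ i.val_lt).2.2.2
  refine ⟨d, inferInstance, fun i => p i.val, fun i => ε i.val, ⟨hε, ?_, ?_⟩, ?_, ?_, ?_⟩
  · intro i h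
    have h1 := hstep i
    simp only at h
    rw [← h, sub_self] at h1
    rcases hε i with h2 | h2 <;> rw [h2] at h1
    · exact hne i (by simpa using h1.symm)
    · exact hne i (by simpa using h1.symm)
  · intro i
    obtain ⟨j, rfl⟩ : ∃ j, i = j + 1 := ⟨i - 1, by ring⟩
    simp only [add_sub_cancel_right]
    rw [hstep, hstep]
    have h1 := hok j
    rcases hε j with e1 | e1 <;> rcases hε (j + 1) with e2 | e2 <;> rw [e1, e2] <;>
      simp only [det, dot, Prod.smul_fst, Prod.smul_snd, smul_eq_mul] at h1 ⊢ <;> intro h0 <;>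
      have h2 := h1 (by linarith) <;> refine ⟨fun h => ?_, fun h => ?_⟩ <;> 
      first | (exfalso; linarith) | norm_num
  · rw [polyA_eq, ← hA, ← sum_zmod]
    simp_rw [hp]
  · rw [polyB, ← hB, ← sum_zmod]
    refine Finset.sum_congr rfl fun i _ => ?_
    have h1 := hstep i
    have h2 := congrArg Prod.fst h1
    have h3 := congrArg Prod.snd h1
    simp only [Prod.fst_sub, Prod.snd_sub, Prod.smul_fst, Prod.smul_snd, smul_eq_mul] at h2 h3
    rw [h2, h3]
    rcases hε i with e | e <;> rw [e] <;> simp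
  · have hn : ∀ i : ZMod d, normalVec (fun i => p i.val) (fun i => ε i.val) i
        = -Complex.I * toC (u i.val) := by
      intro i
      have h1 := hstep i
      have h2 := congrArg (fun z : ℤ × ℤ => (z.1 : ℝ)) h1
      have h3 := congrArg (fun z : ℤ × ℤ => (z.2 : ℝ)) h1
      simp only [Prod.fst_sub, Prod.snd_sub, Prod.smul_fst, Prod.smul_snd, smul_eq_mul] at h2 h3
      push_cast at h2 h3
      have h4 : toC (p (i + 1).val) - toC (p i.val) = (ε i.val : ℂ) * toC (u i.val) := by
        apply Complex.ext
        · simpa [toC] using h2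
        · simpa [toC] using h3
      simp only [normalVec]
      rw [h4]
      rcases hε i with e | e <;> rw [e] <;> simp
    have : ∀ i : ZMod d, Complex.arg (normalVec (fun i => p i.val) (fun i => ε i.val) (i + 1) /
        normalVec (fun i => p i.val) (fun i => ε i.val) i) =
        (fun k => Complex.arg (toC (u (k + 1)) / toC (u k))) i.val := by
      intro i
      rw [hn, hn, mul_div_mul_left _ _ (by simp), hu]
    rw [polyC, Finset.sum_congr rfl (fun i _ => this i),
      sum_zmod (fun k => Complex.arg (toC (u (k + 1)) / toC (u k))), hC]
    have := Real.pi_pos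
    field_simp

/-- a triple `(a, b, c)` with `a, b ∈ ½ℤ`, `c ∈ ℤ`, `a + b ∈ ℤ` is
realized as `(A(P), ½B(P), C(P))` of some lattice multi-polygon `P`, and
conversely every triple arising this way satisfies these conditions. -/
theorem stmt13 (a b : ℝ) (c : ℤ) :
    (∃ (d : ℕ) (_ : NeZero d) (v : ZMod d → ℤ × ℤ) (ε : ZMod d → ℤ),
        IsMultiPolygon v ε ∧ polyA v = a ∧ (polyB v ε : ℝ) / 2 = b ∧ polyC v ε = c)
      ↔ ((∃ m : ℤ, a = m / 2) ∧ (∃ m : ℤ, b = m / 2) ∧ (∃ m : ℤ, a + b = m)) := by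
  constructor
  · rintro ⟨d, _, v, ε, ⟨hε, -, -⟩, rfl, rfl, -⟩
    refine ⟨⟨_, polyA_eq v⟩, ⟨_, rfl⟩, ?_⟩
    have h := parity v ε hε
    rw [ZMod.intCast_zmod_eq_zero_iff_dvd] at h
    obtain ⟨k, hk⟩ := h
    refine ⟨k, ?_⟩
    rw [polyA_eq, ← add_div, ← Int.cast_add, hk]
    push_cast
    ring
  · rintro ⟨⟨m, rfl⟩, ⟨n, rfl⟩, ⟨k, hk⟩⟩
    have h : m + n = 2 * k := by
      have : (m : ℝ) + n = 2 * k := by linarith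
      exact_mod_cast this
    obtain ⟨d, hd, v, ε, h1, h2, h3, h4⟩ := good_real (good_all m n c ⟨k, h⟩)
    exact ⟨d, hd, v, ε, h1, h2, by rw [h3], h4⟩
end
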